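/- arXiv:2006.14082 — 2 statements merged into one kernel-verified Lean document; each statement's English description precedes it below -/
import Mathlib

section
/- Theorem 3.1 (stability estimate for dG(q)). Let q ≥ 0 be an integer and l ∈ ℝ. There is a constant C > 0, independent of T, N, the mesh and the data, such that every U = (U₁,U₂) ∈ 𝒱_q satisfying B(U,V) = L̂(V) for all V ∈ 𝒱_q (with U₁(t) ∈ Ḣ^{l+1}, U₂(t) ∈ Ḣ^{l} for all t) obeys ‖U_{1,N}^−‖_{l+1} + ‖U_{2,N}^−‖_{l} ≤ C ( ‖u₀‖_{l+1} + ‖v₀‖_{l} + ∫₀^T ( ‖f₁(t)‖_{l+1} + ‖f₂(t)‖_{l} ) dt ). -/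
noncomputable section

open scoped RealInnerProductSpace BigOperators
open MeasureTheory

/-- Squared fractional-order norm `‖v‖_α² = Σ_k λ_k^α (v,φ_k)²`. -/
def hsNormSq {H : Type*} [NormedAddCommGroup H] [InnerProductSpace ℝ H]
    (φ : ℕ → H) (lam : ℕ → ℝ) (α : ℝ) (v : H) : ℝ :=
  ∑' k, lam k ^ α * ⟪v, φ k⟫ ^ 2

/-- Fractional-order norm `‖v‖_α`. -/
def hsNorm {H : Type*} [NormedAddCommGroup H] [InnerProductSpace ℝ H]
    (φ : ℕ → H) (lam : ℕ → ℝ) (α : ℝ) (v : H) : ℝ :=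
  Real.sqrt (hsNormSq φ lam α v)

/-- Membership in the fractional-order space `Ḣ^α`. -/
def MemHs {H : Type*} [NormedAddCommGroup H] [InnerProductSpace ℝ H]
    (φ : ℕ → H) (lam : ℕ → ℝ) (α : ℝ) (v : H) : Prop :=
  Summable (fun k => lam k ^ α * ⟪v, φ k⟫ ^ 2)

/-- Weighted spectral pairing `Σ_k λ_k^l (u,φ_k)(v,φ_k)`.
`aPow φ lam 1 u v = a(u,v)`, `aPow φ lam (l+1) u v = a(u, A^l v)` and
`aPow φ lam l u v = (u, A^l v)`. -/
def aPow {H : Type*} [NormedAddCommGroup H] [InnerProductSpace ℝ H]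
    (φ : ℕ → H) (lam : ℕ → ℝ) (l : ℝ) (u v : H) : ℝ :=
  ∑' k, lam k ^ l * ⟪u, φ k⟫ * ⟪v, φ k⟫

/-- The energy bilinear form `a(u,v) = Σ_k λ_k (u,φ_k)(v,φ_k)`. -/
def aForm {H : Type*} [NormedAddCommGroup H] [InnerProductSpace ℝ H]
    (φ : ℕ → H) (lam : ℕ → ℝ) (u v : H) : ℝ :=
  aPow φ lam 1 u v

/-- The operator `A`, determined by `A φ_k = λ_k φ_k`. -/
def Aop {H : Type*} [NormedAddCommGroup H] [InnerProductSpace ℝ H]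
    (φ : ℕ → H) (lam : ℕ → ℝ) (v : H) : H :=
  ∑' k, (lam k * ⟪v, φ k⟫) • φ k

/-- Value at time `s` of the polynomial of degree ≤ q (with coefficients `c n ·`)
attached to the `n`-th time subinterval. -/
def pval {H : Type*} [NormedAddCommGroup H] [InnerProductSpace ℝ H]
    (q : ℕ) (c : ℕ → ℕ → H) (n : ℕ) (s : ℝ) : H :=
  ∑ j ∈ Finset.range (q + 1), s ^ j • c n j

/-- Time derivative of `pval`. -/
def pderiv {H : Type*} [NormedAddCommGroup H] [InnerProductSpace ℝ H]
    (q : ℕ) (c : ℕ → ℕ → H) (n : ℕ) (s : ℝ) : H :=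
  ∑ j ∈ Finset.range (q + 1), ((j : ℝ) * s ^ (j - 1)) • c n j

/-- The dG bilinear form `B((u₁,u₂),(v₁,v₂))`, where the piecewise polynomials
`u₁, u₂, v₁, v₂` are described by their coefficient families `c1, c2, d1, d2`
(on the mesh `0 = tt 0 < tt 1 < ⋯ < tt N`). -/
def Bform {H : Type*} [NormedAddCommGroup H] [InnerProductSpace ℝ H]
    (φ : ℕ → H) (lam : ℕ → ℝ) (tt : ℕ → ℝ) (N q : ℕ)
    (c1 c2 d1 d2 : ℕ → ℕ → H) : ℝ :=
  (∑ n ∈ Finset.Icc 1 N, ∫ s in tt (n-1)..tt n,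
      (aForm φ lam (pderiv q c1 n s) (pval q d1 n s)
        - aForm φ lam (pval q c2 n s) (pval q d1 n s)
        + ⟪pderiv q c2 n s, pval q d2 n s⟫
        + aForm φ lam (pval q c1 n s) (pval q d2 n s)))
  + (∑ n ∈ Finset.Icc 1 (N-1),
      (aForm φ lam (pval q c1 (n+1) (tt n) - pval q c1 n (tt n)) (pval q d1 (n+1) (tt n))
        + ⟪pval q c2 (n+1) (tt n) - pval q c2 n (tt n), pval q d2 (n+1) (tt n)⟫))
  + aForm φ lam (pval q c1 1 (tt 0)) (pval q d1 1 (tt 0))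
  + ⟪pval q c2 1 (tt 0), pval q d2 1 (tt 0)⟫

/-- Supremum of `g` over the open interval `(a,b)`. -/
def supIoo (g : ℝ → ℝ) (a b : ℝ) : ℝ :=
  sSup (g '' Set.Ioo a b)

/-- Squared discrete fractional norm `‖v‖_{h,s}² = ‖A_h^{s/2} v‖²`, expressed through
an orthonormal eigenbasis `e` of `A_h` on `S_h` with eigenvalues `μ`. -/
def hNormSqh {H : Type*} [NormedAddCommGroup H] [InnerProductSpace ℝ H]
    {m : ℕ} (e : Fin m → H) (μ : Fin m → ℝ) (s : ℝ) (v : H) : ℝ :=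
  ∑ i, μ i ^ s * ⟪v, e i⟫ ^ 2

/-- Discrete fractional norm `‖v‖_{h,s}`. -/
def hNormh {H : Type*} [NormedAddCommGroup H] [InnerProductSpace ℝ H]
    {m : ℕ} (e : Fin m → H) (μ : Fin m → ℝ) (s : ℝ) (v : H) : ℝ :=
  Real.sqrt (hNormSqh e μ s v)

/-- Discrete weighted pairing: `aPowh e μ (l+1) u v = a(u, A_h^l v)` and
`aPowh e μ l u v = (u, A_h^l v)` for `u, v ∈ S_h`. -/
def aPowh {H : Type*} [NormedAddCommGroup H] [InnerProductSpace ℝ H]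
    {m : ℕ} (e : Fin m → H) (μ : Fin m → ℝ) (l : ℝ) (u v : H) : ℝ :=
  ∑ i, μ i ^ l * ⟪u, e i⟫ * ⟪v, e i⟫

/-- Inverse estimate: for a fixed degree bound, the maximum of a polynomial on an interval is
controlled by its `L²`-mean, uniformly in the interval. -/
lemma exists_sq_eval_le_integral_sq (q : ℕ) :
    ∃ C : ℝ, 0 ≤ C ∧ ∀ p : Polynomial ℝ, p.natDegree ≤ q → ∀ a b : ℝ, a < b →
      ∀ s ∈ Set.Icc a b, (p.eval s) ^ 2 * (b - a) ≤ C * ∫ t in a..b, (p.eval t) ^ 2 := by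
  classical
  let P : (Fin (q + 1) → ℝ) → ℝ → ℝ := fun c s => ∑ j, c j * s ^ (j : ℕ)
  have hPc : Continuous fun x : (Fin (q + 1) → ℝ) × ℝ => P x.1 x.2 := by fun_prop
  let Q : (Fin (q + 1) → ℝ) → ℝ := fun c => ∫ t in (0 : ℝ)..1, (P c t) ^ 2
  have hQc : Continuous Q :=
    intervalIntegral.continuous_parametric_intervalIntegral_of_continuous' (by fun_prop) 0 1
  have hPsc : ∀ c, Continuous (P c) := fun c => by fun_prop
  have hQpos : ∀ c, c ≠ 0 → 0 < Q c := by
    intro c hc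
    let p : Polynomial ℝ := ∑ j : Fin (q + 1), Polynomial.monomial (j : ℕ) (c j)
    have hpe : ∀ s, p.eval s = P c s := by
      intro s; simp [p, P, Polynomial.eval_finsetSum]
    have hp0 : p ≠ 0 := by
      intro h
      apply hc
      funext i
      have := congrArg (fun r => Polynomial.coeff r (i : ℕ)) h
      simpa [p, Polynomial.finsetSum_coeff, Polynomial.coeff_monomial, Fin.val_inj] using this
    have hex : ∃ s ∈ Set.Icc (0 : ℝ) 1, P c s ≠ 0 := by
      by_contra! h
      apply hp0
      apply Polynomial.eq_zero_of_infinite_isRoot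
      refine (Set.Icc_infinite (zero_lt_one (α := ℝ))).mono fun s hs => ?_
      simpa [Polynomial.IsRoot, hpe] using h s hs
    obtain ⟨s, hs, hne⟩ := hex
    exact intervalIntegral.integral_pos zero_lt_one ((hPsc c).pow 2).continuousOn
      (fun t _ => sq_nonneg _) ⟨s, hs, by positivity⟩
  obtain ⟨c₀, hc₀, hmin⟩ := (isCompact_sphere (0 : Fin (q + 1) → ℝ) 1).exists_isMinOn
    (NormedSpace.sphere_nonempty.mpr zero_le_one) hQc.continuousOn
  have hc₀ne : c₀ ≠ 0 := by
    rintro rfl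
    simp at hc₀
  have hm := hQpos c₀ hc₀ne
  have hQhom : ∀ (r : ℝ) c, Q (r • c) = r ^ 2 * Q c := by
    intro r c
    simp only [Q, P, ← intervalIntegral.integral_const_mul]
    congr 1; funext t
    simp only [Pi.smul_apply, smul_eq_mul, mul_assoc, ← Finset.mul_sum]; ring
  have hnorm : ∀ c, ‖c‖ ^ 2 * Q c₀ ≤ Q c := by
    intro c
    by_cases hc : c = 0
    · subst hc; simpa using (hQhom 0 0).ge
    · have hn : 0 < ‖c‖ := norm_pos_iff.mpr hc
      have h1 : Q c₀ ≤ Q (‖c‖⁻¹ • c) := hmin (by simp [norm_smul, hn.ne'])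
      rw [hQhom] at h1
      calc ‖c‖ ^ 2 * Q c₀ ≤ ‖c‖ ^ 2 * (‖c‖⁻¹ ^ 2 * Q c) := by gcongr
        _ = Q c := by field_simp
  have hPle : ∀ c, ∀ s ∈ Set.Icc (0 : ℝ) 1, |P c s| ≤ (q + 1) * ‖c‖ := by
    intro c s hs
    calc |P c s| ≤ ∑ j, |c j * s ^ (j : ℕ)| := Finset.abs_sum_le_sum_abs _ _
      _ ≤ ∑ _j : Fin (q + 1), ‖c‖ := by
          refine Finset.sum_le_sum fun j _ => ?_
          rw [abs_mul, abs_of_nonneg (pow_nonneg hs.1 _)]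
          have := mul_le_mul (norm_le_pi_norm c j) (pow_le_one₀ (n := (j : ℕ)) hs.1 hs.2)
            (pow_nonneg hs.1 _) (norm_nonneg _)
          simpa using this
      _ = (q + 1) * ‖c‖ := by simp
  refine ⟨(q + 1) ^ 2 / Q c₀, by positivity, fun p hp a b hab s hs => ?_⟩
  have hk : 0 < b - a := sub_pos.mpr hab
  let r : Polynomial ℝ := p.comp (Polynomial.C (b - a) * Polynomial.X + Polynomial.C a)
  let c : Fin (q + 1) → ℝ := fun j => r.coeff j
  have hr : r.natDegree < q + 1 := by
    refine Nat.lt_succ_of_le (Polynomial.natDegree_comp_le.trans ?_)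
    calc _ ≤ p.natDegree * 1 := Nat.mul_le_mul_left _ Polynomial.natDegree_linear_le
      _ ≤ q := by simpa using hp
  have hPr : ∀ t, P c t = p.eval ((b - a) * t + a) := by
    intro t
    have : r.eval t = p.eval ((b - a) * t + a) := by simp [r]
    rw [← this, Polynomial.eval_eq_sum_range' hr, ← Fin.sum_univ_eq_sum_range
      (fun j => r.coeff j * t ^ j)]
  have hint : (b - a) * Q c = ∫ t in a..b, (p.eval t) ^ 2 := by
    simp only [Q, hPr]
    rw [intervalIntegral.integral_comp_mul_add (fun t => (p.eval t) ^ 2) hk.ne']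
    simp [hk.ne']
  have hs' : (s - a) / (b - a) ∈ Set.Icc (0 : ℝ) 1 :=
    ⟨div_nonneg (sub_nonneg.mpr hs.1) hk.le, (div_le_one hk).mpr (by linarith [hs.2])⟩
  have hval : P c ((s - a) / (b - a)) = p.eval s := by
    rw [hPr]; congr 1; field_simp; ring
  have h1 := hPle c _ hs'
  rw [hval] at h1
  have h2 : (p.eval s) ^ 2 ≤ ((q + 1) * ‖c‖) ^ 2 := by
    rw [← sq_abs]; gcongr
  rw [← hint]
  calc (p.eval s) ^ 2 * (b - a) ≤ ((q + 1) * ‖c‖) ^ 2 * (b - a) := by gcongr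
    _ = (q + 1) ^ 2 / Q c₀ * ((b - a) * (‖c‖ ^ 2 * Q c₀)) := by field_simp
    _ ≤ (q + 1) ^ 2 / Q c₀ * ((b - a) * Q c) := by gcongr; exact hnorm c

/-- Backward stability of the oscillator `X' = ω Y + R₁`, `Y' = -ω X + R₂`. -/
lemma norm_oscillator_le (ω : ℝ) (X Y : Polynomial ℝ) (a b M : ℝ)
    (hX : ∀ s ∈ Set.Icc a b, |X.derivative.eval s - ω * Y.eval s| ≤ M)
    (hY : ∀ s ∈ Set.Icc a b, |Y.derivative.eval s + ω * X.eval s| ≤ M)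
    (s : ℝ) (hs : s ∈ Set.Icc a b) :
    ‖(⟨X.eval s, Y.eval s⟩ : ℂ)‖ ≤ ‖(⟨X.eval b, Y.eval b⟩ : ℂ)‖ + 2 * M * (b - a) := by
  let z : ℝ → ℂ := fun t => ((X.eval t : ℝ) : ℂ) + ((Y.eval t : ℝ) : ℂ) * Complex.I
  let e : ℝ → ℂ := fun t => Complex.exp ((ω * t : ℝ) * Complex.I)
  have hz : ∀ t, (⟨X.eval t, Y.eval t⟩ : ℂ) = z t := fun t => by
    apply Complex.ext <;> simp [z]
  have hnorm_e : ∀ t, ‖e t‖ = 1 := fun t => Complex.norm_exp_ofReal_mul_I _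
  have hderiv : ∀ t, HasDerivAt (fun t => e t * z t)
      (e t * (((X.derivative.eval t - ω * Y.eval t : ℝ) : ℂ)
        + ((Y.derivative.eval t + ω * X.eval t : ℝ) : ℂ) * Complex.I)) t := by
    intro t
    have h1 : HasDerivAt z (((X.derivative.eval t : ℝ) : ℂ) + ((Y.derivative.eval t : ℝ) : ℂ) * Complex.I) t :=
      (X.hasDerivAt t).ofReal_comp.add ((Y.hasDerivAt t).ofReal_comp.mul_const _)
    have h2 : HasDerivAt e (e t * ((ω : ℂ) * Complex.I)) t := by
      have h3 : HasDerivAt (fun t : ℝ => ω * t) ω t := by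
        simpa using (hasDerivAt_id t).const_mul ω
      exact (h3.ofReal_comp.mul_const Complex.I).cexp
    refine (h2.mul h1).congr_deriv ?_
    simp only [z]
    push_cast
    linear_combination ((e t) * ω * ((Y.eval t : ℝ) : ℂ)) * Complex.I_mul_I
  have hbound := (convex_Icc a b).norm_image_sub_le_of_norm_hasDerivWithin_le (C := 2 * M)
    (fun t _ => (hderiv t).hasDerivWithinAt) (fun t ht => by
      rw [norm_mul, hnorm_e, one_mul]
      refine (norm_add_le _ _).trans ?_
      rw [norm_mul, Complex.norm_I, mul_one, Complex.norm_real, Complex.norm_real]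
      have := hX t ht
      have := hY t ht
      simp only [Real.norm_eq_abs]
      linarith) (Set.right_mem_Icc.mpr (hs.1.trans hs.2)) hs
  have hM : 0 ≤ M := (abs_nonneg _).trans (hX s hs)
  have hsb : ‖s - b‖ ≤ b - a := by
    rw [Real.norm_eq_abs, abs_le]; constructor <;> linarith [hs.1, hs.2]
  have h4 : ‖e s * z s‖ ≤ ‖e b * z b‖ + ‖e s * z s - e b * z b‖ := by
    simpa using norm_add_le (e b * z b) (e s * z s - e b * z b)
  rw [norm_mul, norm_mul, hnorm_e, hnorm_e, one_mul, one_mul] at h4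
  rw [hz, hz]
  have : 2 * M * ‖s - b‖ ≤ 2 * M * (b - a) := by gcongr
  linarith

/-- Two functions bounded by `M` tested against integrable data. -/
lemma integral_mul_add_mul_le {F₁ F₂ g h : ℝ → ℝ} {a b M : ℝ} (hab : a ≤ b)
    (hF₁ : IntervalIntegrable F₁ volume a b) (hF₂ : IntervalIntegrable F₂ volume a b)
    (hg : Continuous g) (hh : Continuous h)
    (hgM : ∀ s ∈ Set.Icc a b, |g s| ≤ M) (hhM : ∀ s ∈ Set.Icc a b, |h s| ≤ M) :
    ∫ s in a..b, (F₁ s * g s + F₂ s * h s) ≤ M * ∫ s in a..b, (|F₁ s| + |F₂ s|) := by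
  rw [← intervalIntegral.integral_const_mul]
  refine intervalIntegral.integral_mono_on hab
    ((hF₁.mul_continuousOn hg.continuousOn).add (hF₂.mul_continuousOn hh.continuousOn))
    ((hF₁.abs.add hF₂.abs).const_mul M) fun s hs => ?_
  have h1 : F₁ s * g s ≤ |F₁ s| * M := (le_abs_self _).trans <| by
    rw [abs_mul]; exact mul_le_mul_of_nonneg_left (hgM s hs) (abs_nonneg _)
  have h2 : F₂ s * h s ≤ |F₂ s| * M := (le_abs_self _).trans <| by
    rw [abs_mul]; exact mul_le_mul_of_nonneg_left (hhM s hs) (abs_nonneg _)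
  linarith

/-- One step of the dG method for a single oscillator increases the energy norm at most by a
multiple of the `L¹`-norm of the data, uniformly in the frequency and the step size. -/
lemma exists_dG_step_bound (q : ℕ) :
    ∃ K : ℝ, 0 < K ∧ ∀ (ω a b : ℝ), a < b → ∀ (X Y : Polynomial ℝ),
      X.natDegree ≤ q → Y.natDegree ≤ q → ∀ (x₀ y₀ : ℝ) (F₁ F₂ : ℝ → ℝ),
      IntervalIntegrable F₁ volume a b → IntervalIntegrable F₂ volume a b →
      (∀ p r : Polynomial ℝ, p.natDegree ≤ q → r.natDegree ≤ q →
        (∫ s in a..b, ((X.derivative.eval s - ω * Y.eval s) * p.eval s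
            + (Y.derivative.eval s + ω * X.eval s) * r.eval s))
          + (X.eval a - x₀) * p.eval a + (Y.eval a - y₀) * r.eval a
        = ∫ s in a..b, (F₁ s * p.eval s + F₂ s * r.eval s)) →
      ‖(⟨X.eval b, Y.eval b⟩ : ℂ)‖
        ≤ ‖(⟨x₀, y₀⟩ : ℂ)‖ + K * ∫ s in a..b, (|F₁ s| + |F₂ s|) := by
  obtain ⟨C, hC, hinv⟩ := exists_sq_eval_le_integral_sq q
  refine ⟨2 + 4 * C, by positivity, fun ω a b hab X Y hX hY x₀ y₀ F₁ F₂ hF₁ hF₂ heq => ?_⟩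
  set E := ∫ s in a..b, (|F₁ s| + |F₂ s|) with hE
  have hk : 0 < b - a := sub_pos.mpr hab
  have hE0 : 0 ≤ E := intervalIntegral.integral_nonneg hab.le fun s _ => by positivity
  set J := ‖(⟨X.eval a - x₀, Y.eval a - y₀⟩ : ℂ)‖ with hJ
  have hJ0 : 0 ≤ J := norm_nonneg _
  have hJ1 : |X.eval a - x₀| ≤ J := Complex.abs_re_le_norm ⟨X.eval a - x₀, Y.eval a - y₀⟩
  have hJ2 : |Y.eval a - y₀| ≤ J := Complex.abs_im_le_norm ⟨X.eval a - x₀, Y.eval a - y₀⟩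
  have hsq : ∀ x y : ℝ, ‖(⟨x, y⟩ : ℂ)‖ ^ 2 = x ^ 2 + y ^ 2 := fun x y => by
    rw [Complex.sq_norm, Complex.normSq_mk]; ring
  -- the residual
  let R₁ : Polynomial ℝ := X.derivative - Polynomial.C ω * Y
  let R₂ : Polynomial ℝ := Y.derivative + Polynomial.C ω * X
  have hR₁ : R₁.natDegree ≤ q := (Polynomial.natDegree_sub_le _ _).trans <| max_le
    ((Polynomial.natDegree_derivative_le _).trans (by omega))
    ((Polynomial.natDegree_C_mul_le _ _).trans hY)
  have hR₂ : R₂.natDegree ≤ q := (Polynomial.natDegree_add_le _ _).trans <| max_le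
    ((Polynomial.natDegree_derivative_le _).trans (by omega))
    ((Polynomial.natDegree_C_mul_le _ _).trans hX)
  have hR₁e : ∀ s, R₁.eval s = X.derivative.eval s - ω * Y.eval s := fun s => by simp [R₁]
  have hR₂e : ∀ s, R₂.eval s = Y.derivative.eval s + ω * X.eval s := fun s => by simp [R₂]
  let Q := ∫ s in a..b, (R₁.eval s ^ 2 + R₂.eval s ^ 2)
  have hQ0 : 0 ≤ Q := intervalIntegral.integral_nonneg hab.le fun s _ => by positivity
  have hi₁ : IntervalIntegrable (fun s => R₁.eval s ^ 2) volume a b :=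
    (R₁.continuous.pow 2).intervalIntegrable _ _
  have hi₂ : IntervalIntegrable (fun s => R₂.eval s ^ 2) volume a b :=
    (R₂.continuous.pow 2).intervalIntegrable _ _
  have hQsplit : Q = (∫ s in a..b, R₁.eval s ^ 2) + ∫ s in a..b, R₂.eval s ^ 2 :=
    intervalIntegral.integral_add hi₁ hi₂
  have hn₁ : 0 ≤ ∫ s in a..b, R₁.eval s ^ 2 :=
    intervalIntegral.integral_nonneg hab.le fun s _ => by positivity
  have hn₂ : 0 ≤ ∫ s in a..b, R₂.eval s ^ 2 :=
    intervalIntegral.integral_nonneg hab.le fun s _ => by positivity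
  let M := Real.sqrt (C * Q / (b - a))
  have hM0 : 0 ≤ M := Real.sqrt_nonneg _
  have hMsq : M ^ 2 * (b - a) = C * Q := by
    rw [Real.sq_sqrt (by positivity)]; field_simp
  have hM₁ : ∀ s ∈ Set.Icc a b, |R₁.eval s| ≤ M := fun s hs => by
    apply Real.abs_le_sqrt
    rw [le_div_iff₀ hk]
    exact (hinv R₁ hR₁ a b hab s hs).trans (mul_le_mul_of_nonneg_left (by linarith) hC)
  have hM₂ : ∀ s ∈ Set.Icc a b, |R₂.eval s| ≤ M := fun s hs => by
    apply Real.abs_le_sqrt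
    rw [le_div_iff₀ hk]
    exact (hinv R₂ hR₂ a b hab s hs).trans (mul_le_mul_of_nonneg_left (by linarith) hC)
  have hleft : a ∈ Set.Icc a b := Set.left_mem_Icc.mpr hab.le
  have hQle : Q ≤ (2 * J + E) * M := by
    have h1 := heq R₁ R₂ hR₁ hR₂
    have h2 : ∫ s in a..b, ((X.derivative.eval s - ω * Y.eval s) * R₁.eval s
            + (Y.derivative.eval s + ω * X.eval s) * R₂.eval s) = Q := by
      simp only [Q, ← hR₁e, ← hR₂e, ← sq]
    rw [h2] at h1
    have h3 := integral_mul_add_mul_le hab.le hF₁ hF₂ R₁.continuous R₂.continuous hM₁ hM₂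
    have h4 : |(X.eval a - x₀) * R₁.eval a| ≤ J * M := by
      rw [abs_mul]; exact mul_le_mul hJ1 (hM₁ a hleft) (abs_nonneg _) hJ0
    have h5 : |(Y.eval a - y₀) * R₂.eval a| ≤ J * M := by
      rw [abs_mul]; exact mul_le_mul hJ2 (hM₂ a hleft) (abs_nonneg _) hJ0
    linarith [(abs_le.mp h4).1, (abs_le.mp h5).1]
  have hMk : M * (b - a) ≤ C * (2 * J + E) := by
    rcases hM0.eq_or_lt with h | h
    · rw [← h]; simp only [zero_mul]; positivity
    · have : M * (M * (b - a)) ≤ M * (C * (2 * J + E)) := by nlinarith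
      exact le_of_mul_le_mul_left this h
  -- the energy identity
  set G := ‖(⟨X.eval b, Y.eval b⟩ : ℂ)‖ with hG
  set G₀ := ‖(⟨x₀, y₀⟩ : ℂ)‖ with hG₀
  have hG0 : 0 ≤ G₀ := norm_nonneg _
  have hsup : ∀ s ∈ Set.Icc a b,
      ‖(⟨X.eval s, Y.eval s⟩ : ℂ)‖ ≤ G + 2 * (C * (2 * J + E)) := fun s hs => by
    have := norm_oscillator_le ω X Y a b M (fun s hs => hR₁e s ▸ hM₁ s hs)
      (fun s hs => hR₂e s ▸ hM₂ s hs) s hs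
    linarith
  have henergy : G ^ 2 + J ^ 2 - G₀ ^ 2 ≤ 2 * ((G + 2 * (C * (2 * J + E))) * E) := by
    have h1 := heq X Y hX hY
    have h3 := integral_mul_add_mul_le hab.le hF₁ hF₂ X.continuous Y.continuous
      (fun s hs => (Complex.abs_re_le_norm ⟨X.eval s, Y.eval s⟩).trans (hsup s hs))
      (fun s hs => (Complex.abs_im_le_norm ⟨X.eval s, Y.eval s⟩).trans (hsup s hs))
    have h2 : ∫ s in a..b, ((X.derivative.eval s - ω * Y.eval s) * X.eval s
            + (Y.derivative.eval s + ω * X.eval s) * Y.eval s)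
        = (X.eval b ^ 2 + Y.eval b ^ 2) / 2 - (X.eval a ^ 2 + Y.eval a ^ 2) / 2 := by
      refine intervalIntegral.integral_eq_sub_of_hasDerivAt
        (f := fun s => (X.eval s ^ 2 + Y.eval s ^ 2) / 2) (fun s _ => ?_)
        (Continuous.intervalIntegrable (by fun_prop) _ _)
      refine ((((X.hasDerivAt s).pow 2).add ((Y.hasDerivAt s).pow 2)).div_const 2).congr_deriv ?_
      simp
      ring
    rw [h2] at h1
    rw [hG, hJ, hG₀, hsq, hsq, hsq, ← hG, ← hJ]
    linarith
  have h8 : (G - E) ^ 2 ≤ (G₀ + (1 + 4 * C) * E) ^ 2 := by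
    nlinarith [sq_nonneg (J - 4 * C * E), mul_nonneg hC (sq_nonneg E),
      mul_nonneg hG0 (mul_nonneg hC hE0), mul_nonneg hG0 hE0]
  have h9 := abs_le_of_sq_le_sq h8 (by positivity)
  linarith [le_abs_self (G - E)]

/-- Stability of the dG method for a single oscillator. -/
lemma exists_dG_oscillator_bound (q : ℕ) :
    ∃ K : ℝ, 0 < K ∧ ∀ (ω : ℝ) (N : ℕ) (tt : ℕ → ℝ), (∀ n < N, tt n < tt (n + 1)) →
      ∀ (X Y : ℕ → Polynomial ℝ), (∀ n, (X n).natDegree ≤ q) → (∀ n, (Y n).natDegree ≤ q) →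
      ∀ (x y : ℕ → ℝ), (∀ n, x (n + 1) = (X (n + 1)).eval (tt (n + 1))) →
      (∀ n, y (n + 1) = (Y (n + 1)).eval (tt (n + 1))) → ∀ (F₁ F₂ : ℝ → ℝ),
      IntervalIntegrable F₁ volume (tt 0) (tt N) → IntervalIntegrable F₂ volume (tt 0) (tt N) →
      (∀ n < N, ∀ p r : Polynomial ℝ, p.natDegree ≤ q → r.natDegree ≤ q →
        (∫ s in tt n..tt (n + 1),
            (((X (n + 1)).derivative.eval s - ω * (Y (n + 1)).eval s) * p.eval s
            + ((Y (n + 1)).derivative.eval s + ω * (X (n + 1)).eval s) * r.eval s))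
          + ((X (n + 1)).eval (tt n) - x n) * p.eval (tt n)
          + ((Y (n + 1)).eval (tt n) - y n) * r.eval (tt n)
        = ∫ s in tt n..tt (n + 1), (F₁ s * p.eval s + F₂ s * r.eval s)) →
      ‖(⟨x N, y N⟩ : ℂ)‖
        ≤ ‖(⟨x 0, y 0⟩ : ℂ)‖ + K * ∫ s in tt 0..tt N, (|F₁ s| + |F₂ s|) := by
  obtain ⟨K, hK, hstep⟩ := exists_dG_step_bound q
  refine ⟨K, hK, fun ω N tt htt X Y hX hY x y hx hy F₁ F₂ => ?_⟩
  induction N with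
  | zero => intro _ _ _; simp
  | succ N ih =>
    intro hF₁ hF₂ heq
    have hle : ∀ n ≤ N, tt 0 ≤ tt n := fun n hn => by
      induction n with
      | zero => exact le_rfl
      | succ n ihn => exact (ihn (by omega)).trans (htt n (by omega)).le
    have h0N := hle N le_rfl
    have hN := htt N N.lt_succ_self
    have hl : Set.uIcc (tt 0) (tt N) ⊆ Set.uIcc (tt 0) (tt (N + 1)) := by
      rw [Set.uIcc_of_le h0N, Set.uIcc_of_le (h0N.trans hN.le)]
      exact Set.Icc_subset_Icc_right hN.le
    have hr : Set.uIcc (tt N) (tt (N + 1)) ⊆ Set.uIcc (tt 0) (tt (N + 1)) := by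
      rw [Set.uIcc_of_le hN.le, Set.uIcc_of_le (h0N.trans hN.le)]
      exact Set.Icc_subset_Icc_left h0N
    have h1 := ih (fun n hn => htt n (by omega)) (hF₁.mono_set hl) (hF₂.mono_set hl)
      (fun n hn => heq n (by omega))
    have h2 := hstep ω _ _ hN _ _ (hX (N + 1)) (hY (N + 1)) (x N) (y N) F₁ F₂
      (hF₁.mono_set hr) (hF₂.mono_set hr) (heq N N.lt_succ_self)
    have h3 := intervalIntegral.integral_add_adjacent_intervals
      ((hF₁.abs.add hF₂.abs).mono_set hl) ((hF₁.abs.add hF₂.abs).mono_set hr)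
    rw [hx, hy, ← h3, mul_add]
    linarith

section Modes

variable {H : Type*} [NormedAddCommGroup H] [InnerProductSpace ℝ H]

/-- The component along `v` of the polynomial with coefficients `c n ·`. -/
def modePoly (q : ℕ) (c : ℕ → ℕ → H) (v : H) (n : ℕ) : Polynomial ℝ :=
  ∑ j ∈ Finset.range (q + 1), Polynomial.monomial j ⟪c n j, v⟫

lemma modePoly_natDegree_le (q : ℕ) (c : ℕ → ℕ → H) (v : H) (n : ℕ) :
    (modePoly q c v n).natDegree ≤ q :=
  Polynomial.natDegree_sum_le_of_forall_le _ _ fun j hj =>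
    (Polynomial.natDegree_monomial_le _).trans (by simpa [Nat.lt_succ_iff] using hj)

lemma modePoly_eval (q : ℕ) (c : ℕ → ℕ → H) (v : H) (n : ℕ) (s : ℝ) :
    (modePoly q c v n).eval s = ⟪pval q c n s, v⟫ := by
  simp [modePoly, pval, Polynomial.eval_finsetSum, sum_inner, real_inner_smul_left, mul_comm]

lemma modePoly_derivative_eval (q : ℕ) (c : ℕ → ℕ → H) (v : H) (n : ℕ) (s : ℝ) :
    (modePoly q c v n).derivative.eval s = ⟪pderiv q c n s, v⟫ := by
  simp only [modePoly, pderiv, Polynomial.derivative_sum, Polynomial.derivative_monomial,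
    Polynomial.eval_finsetSum, Polynomial.eval_monomial, sum_inner, real_inner_smul_left]
  exact Finset.sum_congr rfl fun j _ => by ring

/-- The coefficients of the test function `p v` supported on the `n`-th subinterval. -/
def testCoeff (p : Polynomial ℝ) (v : H) (n : ℕ) : ℕ → ℕ → H :=
  fun m j => if m = n then p.coeff j • v else 0

lemma pval_testCoeff_self {q : ℕ} {p : Polynomial ℝ} (hp : p.natDegree ≤ q) (v : H) (n : ℕ)
    (s : ℝ) : pval q (testCoeff p v n) n s = p.eval s • v := by
  rw [Polynomial.eval_eq_sum_range' (Nat.lt_succ_of_le hp), Finset.sum_smul]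
  exact Finset.sum_congr rfl fun j _ => by simp [testCoeff, smul_smul, mul_comm]

lemma pval_testCoeff_of_ne (q : ℕ) (p : Polynomial ℝ) (v : H) {m n : ℕ} (h : m ≠ n) (s : ℝ) :
    pval q (testCoeff p v n) m s = 0 := by
  simp [pval, testCoeff, h]

lemma memHs_testCoeff {φ : ℕ → H} (hφ : Orthonormal ℝ φ) (lam : ℕ → ℝ) (α : ℝ)
    (p : Polynomial ℝ) (k n m j : ℕ) : MemHs φ lam α (testCoeff p (φ k) n m j) := by
  refine summable_of_ne_finset_zero (s := {k}) fun i hi => ?_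
  have hki : k ≠ i := fun h => hi (by simp [h])
  have : ⟪testCoeff p (φ k) n m j, φ i⟫ = 0 := by
    unfold testCoeff
    split_ifs
    · rw [real_inner_smul_left, hφ.2 hki, mul_zero]
    · exact inner_zero_left _
  simp [this]

lemma aForm_zero_right (φ : ℕ → H) (lam : ℕ → ℝ) (u : H) : aForm φ lam u 0 = 0 := by
  simp [aForm, aPow]

lemma aForm_smul_eigenvector {φ : ℕ → H} (hφ : Orthonormal ℝ φ) (lam : ℕ → ℝ) (u : H) (x : ℝ)
    (k : ℕ) : aForm φ lam u (x • φ k) = lam k * ⟪u, φ k⟫ * x := by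
  unfold aForm aPow
  rw [tsum_eq_single k]
  · rw [real_inner_smul_left, real_inner_self_eq_norm_sq, hφ.1 k, Real.rpow_one]; ring
  · intro i hi
    rw [real_inner_smul_left, hφ.2 hi.symm]; ring

/-- Testing the dG problem on a single subinterval along a single eigenvector. -/
lemma dG_mode_equation {φ : ℕ → H} (hφ : Orthonormal ℝ φ) (lam : ℕ → ℝ) (q N : ℕ)
    (tt : ℕ → ℝ) (f1 f2 : ℝ → H) (u0 v0 : H) (c1 c2 : ℕ → ℕ → H)
    (hB : ∀ d1 d2 : ℕ → ℕ → H, (∀ n j, MemHs φ lam 1 (d1 n j)) →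
        (∀ n j, MemHs φ lam 1 (d2 n j)) →
        Bform φ lam tt N q c1 c2 d1 d2 =
          (∑ n ∈ Finset.Icc 1 N, ∫ s in tt (n-1)..tt n,
              (aForm φ lam (f1 s) (pval q d1 n s) + ⟪f2 s, pval q d2 n s⟫))
            + aForm φ lam u0 (pval q d1 1 (tt 0)) + ⟪v0, pval q d2 1 (tt 0)⟫)
    (k m : ℕ) (hm : m < N) (p r : Polynomial ℝ) (hp : p.natDegree ≤ q) (hr : r.natDegree ≤ q) :
    (∫ s in tt m..tt (m + 1),
        (lam k * ⟪pderiv q c1 (m + 1) s, φ k⟫ * p.eval s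
          - lam k * ⟪pval q c2 (m + 1) s, φ k⟫ * p.eval s
          + ⟪pderiv q c2 (m + 1) s, φ k⟫ * r.eval s
          + lam k * ⟪pval q c1 (m + 1) s, φ k⟫ * r.eval s))
      + lam k * (⟪pval q c1 (m + 1) (tt m), φ k⟫
          - ⟪if m = 0 then u0 else pval q c1 m (tt m), φ k⟫) * p.eval (tt m)
      + (⟪pval q c2 (m + 1) (tt m), φ k⟫
          - ⟪if m = 0 then v0 else pval q c2 m (tt m), φ k⟫) * r.eval (tt m)
    = ∫ s in tt m..tt (m + 1),
        (lam k * ⟪f1 s, φ k⟫ * p.eval s + ⟪f2 s, φ k⟫ * r.eval s) := by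
  have h := hB (testCoeff p (φ k) (m + 1)) (testCoeff r (φ k) (m + 1))
    (fun _ _ => memHs_testCoeff hφ lam 1 _ _ _ _ _) (fun _ _ => memHs_testCoeff hφ lam 1 _ _ _ _ _)
  have hmem : m + 1 ∈ Finset.Icc 1 N := by simp; omega
  unfold Bform at h
  rw [Finset.sum_eq_single_of_mem (m + 1) hmem (fun n _ hn => by
      simp [pval_testCoeff_of_ne q _ _ hn, aForm_zero_right]),
    Finset.sum_eq_single_of_mem (m + 1) hmem (fun n _ hn => by
      simp [pval_testCoeff_of_ne q _ _ hn, aForm_zero_right])] at h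
  simp only [Nat.add_sub_cancel, pval_testCoeff_self hp, pval_testCoeff_self hr,
    aForm_smul_eigenvector hφ, real_inner_smul_right] at h
  simp only [mul_comm (Polynomial.eval _ r)] at h
  rcases Nat.eq_zero_or_pos m with rfl | hpos
  · rw [Finset.sum_eq_zero (fun n hn => by
      have hn1 : n + 1 ≠ 0 + 1 := by simp at hn; omega
      simp [pval_testCoeff_of_ne q _ _ hn1, aForm_zero_right])] at h
    simp only [zero_add, pval_testCoeff_self hp, pval_testCoeff_self hr,
      aForm_smul_eigenvector hφ, real_inner_smul_right] at h
    simp only [zero_add, if_true]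
    linear_combination h
  · have hmem' : m ∈ Finset.Icc 1 (N - 1) := by simp; omega
    have h1m : 1 ≠ m + 1 := by omega
    rw [Finset.sum_eq_single_of_mem m hmem' (fun n _ hn => by
      have hn1 : n + 1 ≠ m + 1 := by omega
      simp [pval_testCoeff_of_ne q _ _ hn1, aForm_zero_right])] at h
    simp only [pval_testCoeff_self hp, pval_testCoeff_self hr,
      pval_testCoeff_of_ne q _ _ h1m, aForm_zero_right, inner_zero_right,
      aForm_smul_eigenvector hφ, real_inner_smul_right, inner_sub_left] at h
    simp only [hpos.ne', if_false]
    linear_combination h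

/-- Absolute value of the `k`-th coordinate of `v`, weighted as in `hsNorm φ lam α`. -/
def hsCoord (φ : ℕ → H) (lam : ℕ → ℝ) (α : ℝ) (k : ℕ) (v : H) : ℝ :=
  Real.sqrt (lam k ^ α) * |⟪v, φ k⟫|

lemma hsCoord_nonneg (φ : ℕ → H) (lam : ℕ → ℝ) (α : ℝ) (k : ℕ) (v : H) :
    0 ≤ hsCoord φ lam α k v :=
  mul_nonneg (Real.sqrt_nonneg _) (abs_nonneg _)

lemma hsCoord_sq (φ : ℕ → H) {lam : ℕ → ℝ} (hlam : ∀ k, 0 < lam k) (α : ℝ) (k : ℕ) (v : H) :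
    hsCoord φ lam α k v ^ 2 = lam k ^ α * ⟪v, φ k⟫ ^ 2 := by
  rw [hsCoord, mul_pow, Real.sq_sqrt (Real.rpow_nonneg (hlam k).le _), sq_abs]

lemma sqrt_sum_hsCoord_sq_le (φ : ℕ → H) {lam : ℕ → ℝ} (hlam : ∀ k, 0 < lam k) (α : ℝ) {v : H}
    (hv : MemHs φ lam α v) (s : Finset ℕ) :
    Real.sqrt (∑ k ∈ s, hsCoord φ lam α k v ^ 2) ≤ hsNorm φ lam α v := by
  simp only [hsCoord_sq φ hlam]
  exact Real.sqrt_le_sqrt (hv.sum_le_tsum s fun k _ =>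
    mul_nonneg (Real.rpow_nonneg (hlam k).le _) (sq_nonneg _))

lemma hsCoord_le_hsNorm (φ : ℕ → H) {lam : ℕ → ℝ} (hlam : ∀ k, 0 < lam k) (α : ℝ) {v : H}
    (hv : MemHs φ lam α v) (k : ℕ) : hsCoord φ lam α k v ≤ hsNorm φ lam α v := by
  simpa [Real.sqrt_sq (hsCoord_nonneg φ lam α k v)] using sqrt_sum_hsCoord_sq_le φ hlam α hv {k}

lemma sum_mul_hsCoord_le (φ : ℕ → H) {lam : ℕ → ℝ} (hlam : ∀ k, 0 < lam k) (α : ℝ) {v : H}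
    (hv : MemHs φ lam α v) (s : Finset ℕ) (D : ℕ → ℝ) :
    ∑ k ∈ s, D k * hsCoord φ lam α k v
      ≤ Real.sqrt (∑ k ∈ s, D k ^ 2) * hsNorm φ lam α v :=
  (Real.sum_mul_le_sqrt_mul_sqrt s _ _).trans <|
    mul_le_mul_of_nonneg_left (sqrt_sum_hsCoord_sq_le φ hlam α hv s) (Real.sqrt_nonneg _)

lemma hsNorm_le_of_forall_finset (φ : ℕ → H) {lam : ℕ → ℝ} (hlam : ∀ k, 0 < lam k) (α : ℝ)
    {v : H} {R : ℝ} (hR : 0 ≤ R)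
    (h : ∀ s : Finset ℕ, ∑ k ∈ s, hsCoord φ lam α k v ^ 2 ≤ R ^ 2) :
    hsNorm φ lam α v ≤ R := by
  refine Real.sqrt_le_iff.mpr ⟨hR, ?_⟩
  simp only [hsCoord_sq φ hlam] at h
  exact Real.tsum_le_of_sum_le (fun k =>
    mul_nonneg (Real.rpow_nonneg (hlam k).le _) (sq_nonneg _)) h

lemma intervalIntegrable_inner (φ : ℕ → H) {lam : ℕ → ℝ} (hlam : ∀ k, 0 < lam k) (α : ℝ)
    {f : ℝ → H} (hf : AEStronglyMeasurable f volume) (hmem : ∀ t, MemHs φ lam α (f t)) {a b : ℝ}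
    (hint : IntervalIntegrable (fun t => hsNorm φ lam α (f t)) volume a b) (k : ℕ) :
    IntervalIntegrable (fun t => ⟪f t, φ k⟫) volume a b := by
  have hpos : 0 < Real.sqrt (lam k ^ α) := Real.sqrt_pos.mpr (Real.rpow_pos_of_pos (hlam k) _)
  refine (hint.const_mul (Real.sqrt (lam k ^ α))⁻¹).mono_fun'
    (hf.inner aestronglyMeasurable_const).restrict (Filter.Eventually.of_forall fun t => ?_)
  have h := hsCoord_le_hsNorm φ hlam α (hmem t) k
  rw [hsCoord] at h
  simp only [Real.norm_eq_abs]
  rw [inv_mul_eq_div, le_div_iff₀ hpos]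
  linarith

/-- `ℓ²`-summation over modes of a bound involving time integrals. -/
lemma sqrt_sum_sq_le_of_mode_bound (φ : ℕ → H) {lam : ℕ → ℝ} (hlam : ∀ k, 0 < lam k) (l K T : ℝ)
    (hK : 0 ≤ K) (hT : 0 ≤ T) {u0 v0 : H} {f1 f2 : ℝ → H}
    (hu0 : MemHs φ lam (l + 1) u0) (hv0 : MemHs φ lam l v0)
    (hf1 : ∀ t, MemHs φ lam (l + 1) (f1 t)) (hf2 : ∀ t, MemHs φ lam l (f2 t))
    (hi1 : IntervalIntegrable (fun t => hsNorm φ lam (l + 1) (f1 t)) volume 0 T)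
    (hi2 : IntervalIntegrable (fun t => hsNorm φ lam l (f2 t)) volume 0 T)
    (hc1 : ∀ k, IntervalIntegrable (fun t => hsCoord φ lam (l + 1) k (f1 t)) volume 0 T)
    (hc2 : ∀ k, IntervalIntegrable (fun t => hsCoord φ lam l k (f2 t)) volume 0 T)
    (D : ℕ → ℝ) (hD0 : ∀ k, 0 ≤ D k)
    (hD : ∀ k, D k ≤ hsCoord φ lam (l + 1) k u0 + hsCoord φ lam l k v0
      + K * ∫ t in (0 : ℝ)..T, (hsCoord φ lam (l + 1) k (f1 t) + hsCoord φ lam l k (f2 t)))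
    (s : Finset ℕ) :
    Real.sqrt (∑ k ∈ s, D k ^ 2) ≤ hsNorm φ lam (l + 1) u0 + hsNorm φ lam l v0
      + K * ∫ t in (0 : ℝ)..T, (hsNorm φ lam (l + 1) (f1 t) + hsNorm φ lam l (f2 t)) := by
  set S := Real.sqrt (∑ k ∈ s, D k ^ 2) with hS
  have hS0 : 0 ≤ S := Real.sqrt_nonneg _
  have hSsq : S * S = ∑ k ∈ s, D k ^ 2 :=
    Real.mul_self_sqrt (Finset.sum_nonneg fun k _ => sq_nonneg _)
  have hcoord : ∀ k ∈ s, IntervalIntegrable (fun t => D k * (hsCoord φ lam (l + 1) k (f1 t)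
      + hsCoord φ lam l k (f2 t))) volume 0 T := fun k _ => ((hc1 k).add (hc2 k)).const_mul _
  have hint : ∑ k ∈ s, D k * ∫ t in (0 : ℝ)..T,
        (hsCoord φ lam (l + 1) k (f1 t) + hsCoord φ lam l k (f2 t))
      ≤ S * ∫ t in (0 : ℝ)..T, (hsNorm φ lam (l + 1) (f1 t) + hsNorm φ lam l (f2 t)) := by
    simp only [← intervalIntegral.integral_const_mul]
    rw [← intervalIntegral.integral_finsetSum hcoord]
    refine intervalIntegral.integral_mono_on hT ?_ ((hi1.add hi2).const_mul S) fun t _ => ?_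
    · simpa only [Finset.sum_fn] using IntervalIntegrable.sum s hcoord
    · simp only [mul_add, Finset.sum_add_distrib]
      exact add_le_add (sum_mul_hsCoord_le φ hlam _ (hf1 t) s D)
        (sum_mul_hsCoord_le φ hlam _ (hf2 t) s D)
  have hmain : S * S ≤ S * (hsNorm φ lam (l + 1) u0 + hsNorm φ lam l v0
      + K * ∫ t in (0 : ℝ)..T, (hsNorm φ lam (l + 1) (f1 t) + hsNorm φ lam l (f2 t))) := by
    calc S * S ≤ ∑ k ∈ s, D k * (hsCoord φ lam (l + 1) k u0 + hsCoord φ lam l k v0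
          + K * ∫ t in (0 : ℝ)..T,
            (hsCoord φ lam (l + 1) k (f1 t) + hsCoord φ lam l k (f2 t))) := by
          rw [hSsq]
          refine Finset.sum_le_sum fun k _ => ?_
          rw [sq]
          exact mul_le_mul_of_nonneg_left (hD k) (hD0 k)
      _ = ∑ k ∈ s, D k * hsCoord φ lam (l + 1) k u0 + ∑ k ∈ s, D k * hsCoord φ lam l k v0
          + K * ∑ k ∈ s, D k * ∫ t in (0 : ℝ)..T,
            (hsCoord φ lam (l + 1) k (f1 t) + hsCoord φ lam l k (f2 t)) := by
          rw [Finset.mul_sum, ← Finset.sum_add_distrib, ← Finset.sum_add_distrib]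
          exact Finset.sum_congr rfl fun k _ => by ring
      _ ≤ S * hsNorm φ lam (l + 1) u0 + S * hsNorm φ lam l v0 + K * (S *
          ∫ t in (0 : ℝ)..T, (hsNorm φ lam (l + 1) (f1 t) + hsNorm φ lam l (f2 t))) :=
          add_le_add (add_le_add (sum_mul_hsCoord_le φ hlam _ hu0 s D)
            (sum_mul_hsCoord_le φ hlam _ hv0 s D)) (mul_le_mul_of_nonneg_left hint hK)
      _ = _ := by ring
  rcases hS0.eq_or_lt with h | h
  · rw [← h]
    have : 0 ≤ ∫ t in (0 : ℝ)..T, (hsNorm φ lam (l + 1) (f1 t) + hsNorm φ lam l (f2 t)) :=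
      intervalIntegral.integral_nonneg hT fun t _ =>
        add_nonneg (Real.sqrt_nonneg _) (Real.sqrt_nonneg _)
    have h1 : 0 ≤ hsNorm φ lam (l + 1) u0 := Real.sqrt_nonneg _
    have h2 : 0 ≤ hsNorm φ lam l v0 := Real.sqrt_nonneg _
    positivity
  · exact le_of_mul_le_mul_left hmain h

end Modes

/-- **Theorem 3.1 (stability estimate for dG(q)).**
There is a constant `C > 0`, independent of `T`, `N`, the mesh and the data,
such that every solution `U = (U₁,U₂) ∈ 𝒱_q` (coefficient families `c1, c2`)
of the generalized discrete problem `B(U,V) = L̂(V)` satisfies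
`‖U_{1,N}^-‖_{l+1} + ‖U_{2,N}^-‖_l ≤ C (‖u₀‖_{l+1} + ‖v₀‖_l + ∫₀ᵀ (‖f₁‖_{l+1} + ‖f₂‖_l))`. -/
theorem dG_stability_estimate
    {H : Type*} [NormedAddCommGroup H] [InnerProductSpace ℝ H] [CompleteSpace H]
    (φ : ℕ → H) (lam : ℕ → ℝ)
    (hφ : Orthonormal ℝ φ)
    (hφtotal : (Submodule.span ℝ (Set.range φ)).topologicalClosure = ⊤)
    (hlam_pos : ∀ k, 0 < lam k) (hlam_mono : Monotone lam)
    (hlam_top : Filter.Tendsto lam Filter.atTop Filter.atTop)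
    (q : ℕ) (l : ℝ) :
    ∃ C : ℝ, 0 < C ∧
      ∀ (T : ℝ), 0 < T → ∀ (N : ℕ), 1 ≤ N →
      ∀ tt : ℕ → ℝ, tt 0 = 0 → tt N = T → (∀ n < N, tt n < tt (n + 1)) →
      ∀ f1 f2 : ℝ → H, ∀ u0 v0 : H,
      MemHs φ lam (l+1) u0 → MemHs φ lam l v0 →
      AEStronglyMeasurable f1 volume → AEStronglyMeasurable f2 volume →
      (∀ t, MemHs φ lam (l+1) (f1 t)) → (∀ t, MemHs φ lam l (f2 t)) →
      IntervalIntegrable (fun t => hsNorm φ lam (l+1) (f1 t)) volume 0 T →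
      IntervalIntegrable (fun t => hsNorm φ lam l (f2 t)) volume 0 T →
      ∀ c1 c2 : ℕ → ℕ → H,
      (∀ n j, MemHs φ lam 1 (c1 n j)) → (∀ n j, MemHs φ lam 1 (c2 n j)) →
      (∀ n j, MemHs φ lam (l+1) (c1 n j)) → (∀ n j, MemHs φ lam l (c2 n j)) →
      -- B(U,V) = L̂(V) for every V = (V₁,V₂) ∈ 𝒱_q
      (∀ d1 d2 : ℕ → ℕ → H, (∀ n j, MemHs φ lam 1 (d1 n j)) →
        (∀ n j, MemHs φ lam 1 (d2 n j)) →
        Bform φ lam tt N q c1 c2 d1 d2 =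
          (∑ n ∈ Finset.Icc 1 N, ∫ s in tt (n-1)..tt n,
              (aForm φ lam (f1 s) (pval q d1 n s) + ⟪f2 s, pval q d2 n s⟫))
            + aForm φ lam u0 (pval q d1 1 (tt 0)) + ⟪v0, pval q d2 1 (tt 0)⟫) →
      hsNorm φ lam (l+1) (pval q c1 N (tt N)) + hsNorm φ lam l (pval q c2 N (tt N))
        ≤ C * (hsNorm φ lam (l+1) u0 + hsNorm φ lam l v0
            + ∫ t in (0:ℝ)..T, (hsNorm φ lam (l+1) (f1 t) + hsNorm φ lam l (f2 t))) := by
  obtain ⟨K, hK, hosc⟩ := exists_dG_oscillator_bound q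
  refine ⟨2 * (1 + K), by positivity, ?_⟩
  intro T hT N hN tt ht0 htN htt f1 f2 u0 v0 hu0 hv0 hm1 hm2 hf1 hf2 hi1 hi2 c1 c2 _ _ _ _ hB
  have hin1 := intervalIntegrable_inner φ hlam_pos (l + 1) hm1 hf1 hi1
  have hin2 := intervalIntegrable_inner φ hlam_pos l hm2 hf2 hi2
  have hweight : ∀ k, Real.sqrt (lam k ^ (l + 1))
      = Real.sqrt (lam k ^ l) * Real.sqrt (lam k) := fun k => by
    rw [Real.rpow_add (hlam_pos k), Real.rpow_one,
      Real.sqrt_mul (Real.rpow_nonneg (hlam_pos k).le _)]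
  have hc1 : ∀ k, IntervalIntegrable (fun t => hsCoord φ lam (l + 1) k (f1 t)) volume 0 T :=
    fun k => (hin1 k).abs.const_mul _
  have hc2 : ∀ k, IntervalIntegrable (fun t => hsCoord φ lam l k (f2 t)) volume 0 T :=
    fun k => (hin2 k).abs.const_mul _
  -- weighted energy norm of the `k`-th mode at the final time
  let D : ℕ → ℝ := fun k => Real.sqrt (lam k ^ l) * ‖(⟨Real.sqrt (lam k)
    * ⟪pval q c1 N (tt N), φ k⟫, ⟪pval q c2 N (tt N), φ k⟫⟩ : ℂ)‖
  have hD0 : ∀ k, 0 ≤ D k := fun k => mul_nonneg (Real.sqrt_nonneg _) (norm_nonneg _)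
  have hD1 : ∀ k, hsCoord φ lam (l + 1) k (pval q c1 N (tt N)) ≤ D k := fun k => by
    rw [hsCoord, hweight, mul_assoc]
    refine mul_le_mul_of_nonneg_left ?_ (Real.sqrt_nonneg _)
    rw [← abs_of_nonneg (Real.sqrt_nonneg (lam k)), ← abs_mul,
      abs_of_nonneg (Real.sqrt_nonneg (lam k))]
    exact Complex.abs_re_le_norm ⟨_, _⟩
  have hD2 : ∀ k, hsCoord φ lam l k (pval q c2 N (tt N)) ≤ D k := fun k =>
    mul_le_mul_of_nonneg_left (Complex.abs_im_le_norm ⟨_, _⟩) (Real.sqrt_nonneg _)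
  have hD : ∀ k, D k ≤ hsCoord φ lam (l + 1) k u0 + hsCoord φ lam l k v0
      + K * ∫ t in (0 : ℝ)..T, (hsCoord φ lam (l + 1) k (f1 t) + hsCoord φ lam l k (f2 t)) := by
    intro k
    set ω := Real.sqrt (lam k) with hω
    have hω0 : 0 < ω := Real.sqrt_pos.mpr (hlam_pos k)
    have hωsq : lam k = ω * ω := (Real.mul_self_sqrt (hlam_pos k).le).symm
    have h := hosc ω N tt htt (fun n => Polynomial.C ω * modePoly q c1 (φ k) n)
      (fun n => modePoly q c2 (φ k) n)
      (fun n => (Polynomial.natDegree_C_mul_le _ _).trans (modePoly_natDegree_le _ _ _ _))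
      (fun n => modePoly_natDegree_le _ _ _ _)
      (fun n => ω * ⟪if n = 0 then u0 else pval q c1 n (tt n), φ k⟫)
      (fun n => ⟪if n = 0 then v0 else pval q c2 n (tt n), φ k⟫)
      (fun n => by simp [modePoly_eval]) (fun n => by simp [modePoly_eval])
      (fun s => ω * ⟪f1 s, φ k⟫) (fun s => ⟪f2 s, φ k⟫)
      (by rw [ht0, htN]; exact (hin1 k).const_mul ω) (by rw [ht0, htN]; exact hin2 k)
      (fun n hn p r hp hr => by
        have h := dG_mode_equation hφ lam q N tt f1 f2 u0 v0 c1 c2 hB k n hn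
          (Polynomial.C ω⁻¹ * p) r ((Polynomial.natDegree_C_mul_le _ _).trans hp) hr
        simp only [Polynomial.eval_mul, Polynomial.eval_C, Polynomial.derivative_C_mul,
          modePoly_eval, modePoly_derivative_eval]
        simp only [Polynomial.eval_mul, Polynomial.eval_C, hωsq] at h
        convert h using 1
        · congr 1
          congr 1
          · refine intervalIntegral.integral_congr fun s _ => ?_
            field_simp
            ring
          · field_simp
        · refine intervalIntegral.integral_congr fun s _ => ?_
          field_simp)
    simp only [show N ≠ 0 by omega, if_true, if_false, ht0] at h
    have h0 : ‖(⟨ω * ⟪u0, φ k⟫, ⟪v0, φ k⟫⟩ : ℂ)‖ ≤ ω * |⟪u0, φ k⟫| + |⟪v0, φ k⟫| := by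
      refine (Complex.norm_le_abs_re_add_abs_im _).trans_eq ?_
      simp only [abs_mul, abs_of_pos hω0]
    have hint : ∫ t in (0 : ℝ)..T, (hsCoord φ lam (l + 1) k (f1 t) + hsCoord φ lam l k (f2 t))
        = Real.sqrt (lam k ^ l) * ∫ t in (0 : ℝ)..T, (|ω * ⟪f1 t, φ k⟫| + |⟪f2 t, φ k⟫|) := by
      rw [← intervalIntegral.integral_const_mul]
      refine intervalIntegral.integral_congr fun t _ => ?_
      simp only [hsCoord, hweight, abs_mul, abs_of_pos hω0, ← hω]
      ring
    rw [hint, hsCoord, hsCoord, hweight, ← hω]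
    calc D k ≤ Real.sqrt (lam k ^ l) * (ω * |⟪u0, φ k⟫| + |⟪v0, φ k⟫|
          + K * ∫ t in (0 : ℝ)..T, (|ω * ⟪f1 t, φ k⟫| + |⟪f2 t, φ k⟫|)) := by
          refine mul_le_mul_of_nonneg_left ?_ (Real.sqrt_nonneg _)
          rw [htN] at h ⊢
          linarith
      _ = _ := by ring
  set I := ∫ t in (0 : ℝ)..T, (hsNorm φ lam (l + 1) (f1 t) + hsNorm φ lam l (f2 t)) with hI
  set R := hsNorm φ lam (l + 1) u0 + hsNorm φ lam l v0 + K * I with hR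
  have hI0 : 0 ≤ I := intervalIntegral.integral_nonneg hT.le fun t _ =>
    add_nonneg (Real.sqrt_nonneg _) (Real.sqrt_nonneg _)
  have hn1 : 0 ≤ hsNorm φ lam (l + 1) u0 := Real.sqrt_nonneg _
  have hn2 : 0 ≤ hsNorm φ lam l v0 := Real.sqrt_nonneg _
  have hR0 : 0 ≤ R := by positivity
  have hDR : ∀ s : Finset ℕ, ∑ k ∈ s, D k ^ 2 ≤ R ^ 2 := fun s =>
    (Real.sqrt_le_left hR0).mp (sqrt_sum_sq_le_of_mode_bound φ hlam_pos l K T hK.le hT.le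
      hu0 hv0 hf1 hf2 hi1 hi2 hc1 hc2 D hD0 hD s)
  have h1 : hsNorm φ lam (l + 1) (pval q c1 N (tt N)) ≤ R :=
    hsNorm_le_of_forall_finset φ hlam_pos _ hR0 fun s => (Finset.sum_le_sum fun k _ =>
      pow_le_pow_left₀ (hsCoord_nonneg _ _ _ _ _) (hD1 k) 2).trans (hDR s)
  have h2 : hsNorm φ lam l (pval q c2 N (tt N)) ≤ R :=
    hsNorm_le_of_forall_finset φ hlam_pos _ hR0 fun s => (Finset.sum_le_sum fun k _ =>
      pow_le_pow_left₀ (hsCoord_nonneg _ _ _ _ _) (hD2 k) 2).trans (hDR s)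
  have hKn1 : 0 ≤ K * hsNorm φ lam (l + 1) u0 := by positivity
  have hKn2 : 0 ≤ K * hsNorm φ lam l v0 := by positivity
  linarith
end
end

section
/- Theorem 4.1, first estimate (nodal error of dG(q) in the energy norm). Let q ≥ 0 be an integer. There is a constant C > 0, independent of T, N and the mesh, such that the error e = (e₁,e₂) := (U₁ − u₁, U₂ − u₂) between the dG(q) approximation and the exact solution satisfies ‖e_{1,N}^−‖₁ + ‖e_{2,N}^−‖ ≤ C Σ_{n=1}^N k_n^{q+1} ∫_{I_n} ( ‖u₂^{(q+1)}(t)‖₁ + ‖u₁^{(q+1)}(t)‖₂ ) dt, provided u₁^{(q+1)} ∈ L¹((0,T);Ḣ²) and u₂^{(q+1)} ∈ L¹((0,T);Ḣ¹). -/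
noncomputable section

open scoped RealInnerProductSpace BigOperators
open MeasureTheory

/-! ### Polynomials on the unit interval -/

namespace DGWave

open Polynomial

/-- The functional `p ↦ ∫₀¹ p`. -/
def unitIntegral : ℝ[X] →ₗ[ℝ] ℝ where
  toFun p := ∫ s in (0 : ℝ)..1, p.eval s
  map_add' p r := by
    simp only [eval_add]
    exact intervalIntegral.integral_add (p.continuous.intervalIntegrable _ _)
      (r.continuous.intervalIntegrable _ _)
  map_smul' c p := by simp

lemma unitIntegral_apply (p : ℝ[X]) : unitIntegral p = ∫ s in (0 : ℝ)..1, p.eval s := rfl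

lemma unitIntegral_derivative (p : ℝ[X]) :
    unitIntegral (derivative p) = p.eval 1 - p.eval 0 := by
  rw [unitIntegral_apply]
  exact intervalIntegral.integral_eq_sub_of_hasDerivAt (fun x _ => p.hasDerivAt x)
    ((derivative p).continuous.intervalIntegrable _ _)

lemma unitIntegral_mul_self_nonneg (p : ℝ[X]) : 0 ≤ unitIntegral (p * p) := by
  rw [unitIntegral_apply]
  refine intervalIntegral.integral_nonneg zero_le_one fun s _ => ?_
  rw [eval_mul]
  exact mul_self_nonneg _

lemma eq_zero_of_unitIntegral_mul_self {p : ℝ[X]} (h : unitIntegral (p * p) = 0) : p = 0 := by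
  by_contra hp
  have hinf : (Set.Icc (0 : ℝ) 1).Infinite := Set.Icc_infinite zero_lt_one
  obtain ⟨c, hc, hroot⟩ : ∃ c ∈ Set.Icc (0 : ℝ) 1, p.eval c ≠ 0 := by
    by_contra! hall
    exact hp (Polynomial.eq_zero_of_infinite_isRoot p (hinf.mono hall))
  have := intervalIntegral.integral_pos (f := fun s => (p * p).eval s) zero_lt_one
    (p * p).continuous.continuousOn
    (fun s _ => by rw [eval_mul]; exact mul_self_nonneg _)
    ⟨c, hc, by rw [eval_mul]; exact mul_self_pos.2 hroot⟩
  rw [unitIntegral_apply] at h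
  exact this.ne' h

lemma unitIntegral_mul_sq_le (p r : ℝ[X]) :
    unitIntegral (p * r) ^ 2 ≤ unitIntegral (p * p) * unitIntegral (r * r) := by
  have := LinearMap.BilinForm.apply_mul_apply_le_of_forall_zero_le
    ((LinearMap.mul ℝ ℝ[X]).compr₂ unitIntegral) (fun x => unitIntegral_mul_self_nonneg x) p r
  simp only [LinearMap.compr₂_apply, LinearMap.mul_apply'] at this
  rwa [mul_comm r p, ← sq] at this

/-- The `L²(0,1)` norm of a polynomial. -/
def unitNorm (p : ℝ[X]) : ℝ := √(unitIntegral (p * p))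

lemma unitNorm_nonneg (p : ℝ[X]) : 0 ≤ unitNorm p := Real.sqrt_nonneg _

lemma unitNorm_sq (p : ℝ[X]) : unitNorm p ^ 2 = unitIntegral (p * p) :=
  Real.sq_sqrt (unitIntegral_mul_self_nonneg p)

lemma abs_unitIntegral_mul_le (p r : ℝ[X]) :
    |unitIntegral (p * r)| ≤ unitNorm p * unitNorm r := by
  refine abs_le_of_sq_le_sq ?_ (mul_nonneg (unitNorm_nonneg p) (unitNorm_nonneg r))
  rw [mul_pow, unitNorm_sq, unitNorm_sq]
  exact unitIntegral_mul_sq_le p r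

lemma unitNorm_one_sub_X_mul_le (p : ℝ[X]) : unitNorm ((1 - X) * p) ≤ unitNorm p := by
  refine Real.sqrt_le_sqrt ?_
  rw [unitIntegral_apply, unitIntegral_apply]
  refine intervalIntegral.integral_mono_on zero_le_one
    (Polynomial.continuous _).continuousOn.intervalIntegrable
    (Polynomial.continuous _).continuousOn.intervalIntegrable fun s hs => ?_
  simp only [eval_mul, eval_sub, eval_one, eval_X]
  nlinarith [mul_self_nonneg (p.eval s), hs.1, hs.2,
    mul_nonneg (mul_self_nonneg (p.eval s)) (mul_nonneg hs.1 (by linarith [hs.2] : 0 ≤ 2 - s))]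

/-- A bilinear form which is injective on a finite-dimensional subspace represents
every linear functional there. -/
lemma exists_bilin_eq_of_injective {M : Type*} [AddCommGroup M] [Module ℝ M]
    (E : Submodule ℝ M) [FiniteDimensional ℝ E] (B : M →ₗ[ℝ] M →ₗ[ℝ] ℝ)
    (hB : ∀ u ∈ E, (∀ v ∈ E, B u v = 0) → u = 0) (l : M →ₗ[ℝ] ℝ) :
    ∃ u ∈ E, ∀ v ∈ E, B u v = l v := by
  let F : E →ₗ[ℝ] Module.Dual ℝ E := B.domRestrict₁₂ E E
  have hinj : Function.Injective F := by
    rw [injective_iff_map_eq_zero]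
    intro u hu
    refine Subtype.ext (hB u u.2 fun v hv => ?_)
    exact LinearMap.congr_fun hu ⟨v, hv⟩
  have hsurj := (LinearMap.injective_iff_surjective_of_finrank_eq_finrank
    (Subspace.dual_finrank_eq (K := ℝ) (V := E)).symm).1 hinj
  obtain ⟨u, hu⟩ := hsurj (l.domRestrict E)
  exact ⟨u, u.2, fun v hv => LinearMap.congr_fun hu ⟨v, hv⟩⟩

lemma exists_unitIntegral_mul_eq (n : ℕ) (l : ℝ[X] →ₗ[ℝ] ℝ) :
    ∃ u ∈ degreeLT ℝ n, ∀ v ∈ degreeLT ℝ n, unitIntegral (u * v) = l v := by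
  refine exists_bilin_eq_of_injective (degreeLT ℝ n)
    ((LinearMap.mul ℝ ℝ[X]).compr₂ unitIntegral) (fun u hu h => ?_) l
  exact eq_zero_of_unitIntegral_mul_self (h u hu)

lemma derivative_mem_degreeLT {n : ℕ} {p : ℝ[X]} (hp : p ∈ degreeLT ℝ n) :
    derivative p ∈ degreeLT ℝ n := by
  rw [mem_degreeLT] at *
  exact (degree_derivative_le).trans_lt hp

lemma exists_abs_le_mul_unitNorm (n : ℕ) (l : ℝ[X] →ₗ[ℝ] ℝ) :
    ∃ c, 0 ≤ c ∧ ∀ p ∈ degreeLT ℝ n, |l p| ≤ c * unitNorm p := by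
  obtain ⟨u, -, hu⟩ := exists_unitIntegral_mul_eq n l
  refine ⟨unitNorm u, unitNorm_nonneg u, fun p hp => ?_⟩
  rw [← hu p hp]
  exact abs_unitIntegral_mul_le u p

/-- Inverse inequality: a linear image of a polynomial of bounded degree is bounded pointwise on
`[0,1]` by the `L²(0,1)` norm. -/
lemma exists_abs_eval_le_mul_unitNorm (n : ℕ) (D : ℝ[X] →ₗ[ℝ] ℝ[X])
    (hD : ∀ p ∈ degreeLT ℝ n, D p ∈ degreeLT ℝ n) :
    ∃ c, 0 ≤ c ∧ ∀ p ∈ degreeLT ℝ n, ∀ t ∈ Set.Icc (0 : ℝ) 1,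
      |(D p).eval t| ≤ c * unitNorm p := by
  choose c hc0 hc using fun j => exists_abs_le_mul_unitNorm n ((lcoeff ℝ j).comp D)
  refine ⟨∑ j ∈ Finset.range n, c j, Finset.sum_nonneg fun j _ => hc0 j, fun p hp t ht => ?_⟩
  rcases Nat.eq_zero_or_pos n with rfl | hn
  · have : D p = 0 := by simpa [mem_degreeLT, degree_lt_iff_coeff_zero] using hD p hp
    simp [this]
  have hdeg : (D p).natDegree < n := by
    have := mem_degreeLT.1 (hD p hp)
    by_cases h0 : D p = 0
    · simpa [h0] using hn
    · exact (natDegree_lt_iff_degree_lt h0).2 this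
  rw [eval_eq_sum_range' hdeg, Finset.sum_mul]
  refine (Finset.abs_sum_le_sum_abs _ _).trans (Finset.sum_le_sum fun j _ => ?_)
  rw [abs_mul, abs_pow, abs_of_nonneg ht.1]
  calc |(D p).coeff j| * t ^ j ≤ |(D p).coeff j| * 1 :=
        mul_le_mul_of_nonneg_left (pow_le_one₀ ht.1 ht.2) (abs_nonneg _)
    _ ≤ c j * unitNorm p := by rw [mul_one]; exact hc j p hp

lemma unitIntegral_derivative_mul_self (p : ℝ[X]) :
    2 * unitIntegral (derivative p * p) = p.eval 1 ^ 2 - p.eval 0 ^ 2 := by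
  have h := unitIntegral_derivative (p * p)
  rw [derivative_mul, map_add, mul_comm p (derivative p)] at h
  simp only [eval_mul] at h
  linarith

lemma unitIntegral_derivative_mul_one_sub_X_mul (p : ℝ[X]) :
    2 * unitIntegral ((1 - X) * p * derivative p) = unitIntegral (p * p) - p.eval 0 ^ 2 := by
  have h := unitIntegral_derivative ((1 - X) * (p * p))
  have e : derivative ((1 - X) * (p * p))
      = (1 - X) * p * derivative p + (1 - X) * p * derivative p - p * p := by
    simp only [derivative_mul, derivative_sub, derivative_one, derivative_X]
    ring
  rw [e, map_sub, map_add] at h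
  simp only [eval_mul, eval_sub, eval_one, eval_X] at h
  linarith

/-- The `L²(0,1)` projection of `(1 - X) * p` onto polynomials of degree less than `n`. -/
lemma exists_weighted_test (n : ℕ) (p : ℝ[X]) :
    ∃ w ∈ degreeLT ℝ n, (∀ v ∈ degreeLT ℝ n,
      unitIntegral (v * w) = unitIntegral ((1 - X) * p * v)) ∧ unitNorm w ≤ unitNorm p := by
  obtain ⟨w, hw, h⟩ := exists_unitIntegral_mul_eq n
    (unitIntegral.comp (LinearMap.mulLeft ℝ ((1 - X) * p)))
  simp only [LinearMap.comp_apply, LinearMap.mulLeft_apply] at h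
  refine ⟨w, hw, fun v hv => by rw [mul_comm v w]; exact h v hv, ?_⟩
  have h1 := (le_abs_self _).trans (abs_unitIntegral_mul_le ((1 - X) * p) w)
  rw [← h w hw, ← unitNorm_sq] at h1
  have h2 := mul_le_mul_of_nonneg_right (unitNorm_one_sub_X_mul_le p) (unitNorm_nonneg w)
  by_contra! hlt
  nlinarith [unitNorm_nonneg p, unitNorm_nonneg w]

lemma energy_bound_arith {K A G s r : ℝ} (hK : 1 ≤ K) (hG : 0 ≤ G) (hr : 0 ≤ r)
    (hA : A ≤ r ^ 2) (h : s ^ 2 ≤ K * (A + G * s)) :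
    s ≤ 2 * K * (r + G) := by
  have h1 : s ^ 2 ≤ 2 * K * A + K ^ 2 * G ^ 2 := by nlinarith [sq_nonneg (s - K * G)]
  refine abs_le_of_sq_le_sq' ?_ (by positivity) |>.2
  have hKA : K * A ≤ K ^ 2 * r ^ 2 := by
    calc K * A ≤ K * r ^ 2 := by gcongr
      _ ≤ K ^ 2 * r ^ 2 := by gcongr; exact le_self_pow₀ hK two_ne_zero
  nlinarith [mul_nonneg hr hG, sq_nonneg r, sq_nonneg (K * r), sq_nonneg (K * G),
    mul_nonneg (sq_nonneg K) (mul_nonneg hr hG)]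

lemma step_bound_arith {c G a b σ τ J x : ℝ} (hG : 0 ≤ G) (sp : 0 ≤ σ) (sr : 0 ≤ τ)
    (hx0 : 0 ≤ x) (hJ0 : 0 ≤ J) (energy : x + J ≤ a ^ 2 + b ^ 2 + 2 * G * (σ + τ))
    (weighted : σ ^ 2 + τ ^ 2 ≤ 4 * (a ^ 2 + b ^ 2) + (4 + 4 * c ^ 2) * J + 4 * G * (σ + τ)) :
    x ≤ a ^ 2 + b ^ 2 + 4 * (24 + 16 * c ^ 2) * G * (|a| + |b| + G) ∧
      σ ≤ 4 * (24 + 16 * c ^ 2) * (|a| + |b| + G) := by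
  have hs : (σ + τ) ^ 2 ≤ (24 + 16 * c ^ 2) * ((a ^ 2 + b ^ 2) + G * (σ + τ)) := by
    have hGs : 0 ≤ G * (σ + τ) := by positivity
    have hJ : J ≤ a ^ 2 + b ^ 2 + 2 * G * (σ + τ) := by
      linarith
    have := mul_le_mul_of_nonneg_left hJ (by positivity : 0 ≤ 4 + 4 * c ^ 2)
    nlinarith [sq_nonneg (σ - τ), mul_nonneg (sq_nonneg c) (by positivity : 0 ≤ a ^ 2 + b ^ 2)]
  have hfin := energy_bound_arith (r := |a| + |b|) (by nlinarith [sq_nonneg c]) hG (by positivity)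
    (by nlinarith [sq_abs a, sq_abs b, mul_nonneg (abs_nonneg a) (abs_nonneg b)]) hs
  have hR : 0 ≤ |a| + |b| + G := by positivity
  constructor
  · have := mul_le_mul_of_nonneg_left hfin hG
    nlinarith [hJ0]
  · nlinarith [mul_nonneg (by positivity : 0 ≤ 24 + 16 * c ^ 2) hR]

/-- Stability of one dG step for a harmonic oscillator, uniform in its frequency. -/
lemma exists_unit_step_stability (n : ℕ) :
    ∃ K : ℝ, 0 < K ∧ ∀ p ∈ degreeLT ℝ n, ∀ r ∈ degreeLT ℝ n, ∀ ω a b G : ℝ, 0 ≤ G →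
      ∀ l₁ l₂ : ℝ[X] → ℝ,
      (∀ v ∈ degreeLT ℝ n, |l₁ v| ≤ G * unitNorm v) →
      (∀ v ∈ degreeLT ℝ n, |l₂ v| ≤ G * unitNorm v) →
      (∀ v ∈ degreeLT ℝ n, unitIntegral (derivative p * v) - ω * unitIntegral (r * v)
        + (p.eval 0 - a) * v.eval 0 = l₁ v) →
      (∀ v ∈ degreeLT ℝ n, unitIntegral (derivative r * v) + ω * unitIntegral (p * v)
        + (r.eval 0 - b) * v.eval 0 = l₂ v) →
      p.eval 1 ^ 2 + r.eval 1 ^ 2 ≤ a ^ 2 + b ^ 2 + K * G * (|a| + |b| + G) ∧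
      unitNorm p ≤ K * (|a| + |b| + G) := by
  obtain ⟨c, hc0, hc⟩ := exists_abs_eval_le_mul_unitNorm n LinearMap.id fun p hp => hp
  simp only [LinearMap.id_apply] at hc
  have hz : (0 : ℝ) ∈ Set.Icc (0 : ℝ) 1 := ⟨le_rfl, zero_le_one⟩
  refine ⟨4 * (24 + 16 * c ^ 2), by positivity, ?_⟩
  intro p hp r hr ω a b G hG l₁ l₂ hl₁ hl₂ h₁ h₂
  obtain ⟨w₁, hw₁, hw₁e, hw₁n⟩ := exists_weighted_test n p
  obtain ⟨w₂, hw₂, hw₂e, hw₂n⟩ := exists_weighted_test n r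
  have E₁ := h₁ p hp
  have E₂ := h₂ r hr
  have W₁ := h₁ w₁ hw₁
  have W₂ := h₂ w₂ hw₂
  rw [hw₁e _ (derivative_mem_degreeLT hp), hw₁e _ hr] at W₁
  rw [hw₂e _ (derivative_mem_degreeLT hr), hw₂e _ hp] at W₂
  have hcomm : unitIntegral ((1 - X) * r * p) = unitIntegral ((1 - X) * p * r) := by
    congr 1; ring
  rw [hcomm] at W₂
  rw [mul_comm p r] at E₂
  have P₁ := unitIntegral_derivative_mul_self p
  have P₂ := unitIntegral_derivative_mul_self r
  have Q₁ := unitIntegral_derivative_mul_one_sub_X_mul p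
  have Q₂ := unitIntegral_derivative_mul_one_sub_X_mul r
  rw [← unitNorm_sq] at Q₁ Q₂
  have bl₁ := abs_le.1 (hl₁ p hp)
  have bl₂ := abs_le.1 (hl₂ r hr)
  have bm₁ := abs_le.1 ((hl₁ w₁ hw₁).trans (mul_le_mul_of_nonneg_left hw₁n hG))
  have bm₂ := abs_le.1 ((hl₂ w₂ hw₂).trans (mul_le_mul_of_nonneg_left hw₂n hG))
  have bw₁ := (hc w₁ hw₁ 0 hz).trans (mul_le_mul_of_nonneg_left hw₁n hc0)
  have bw₂ := (hc w₂ hw₂ 0 hz).trans (mul_le_mul_of_nonneg_left hw₂n hc0)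
  have sp := unitNorm_nonneg p
  have sr := unitNorm_nonneg r
  generalize unitNorm p = σ at *
  generalize unitNorm r = τ at *
  generalize eval 0 w₁ = α at *
  generalize eval 0 w₂ = β at *
  have cross : ∀ j α σ : ℝ, |α| ≤ c * σ → -(2 * (j * α)) ≤ 2 * c ^ 2 * j ^ 2 + σ ^ 2 / 2 := by
    intro j α σ h
    have h' : α ^ 2 ≤ (c * σ) ^ 2 := sq_le_sq' (abs_le.1 h).1 (abs_le.1 h).2
    have h1 : -(2 * (j * α)) ≤ 2 * |j| * |α| := by
      have := neg_le_abs (j * α); rw [abs_mul] at this; linarith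
    have h2 : |j| * |α| ≤ |j| * (c * σ) := mul_le_mul_of_nonneg_left h (abs_nonneg j)
    nlinarith [sq_nonneg (2 * c * |j| - σ), sq_abs j]
  have c₁ := cross (eval 0 p - a) α σ bw₁
  have c₂ := cross (eval 0 r - b) β τ bw₂
  set j₁ := eval 0 p - a with hj₁
  set j₂ := eval 0 r - b with hj₂
  have p0 : eval 0 p = j₁ + a := by rw [hj₁]; ring
  have r0 : eval 0 r = j₂ + b := by rw [hj₂]; ring
  have energy : eval 1 p ^ 2 + eval 1 r ^ 2 + (j₁ ^ 2 + j₂ ^ 2)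
      ≤ a ^ 2 + b ^ 2 + 2 * G * (σ + τ) := by
    rw [p0] at P₁ E₁; rw [r0] at P₂ E₂
    linarith
  have weighted : σ ^ 2 + τ ^ 2 ≤ 4 * (a ^ 2 + b ^ 2) + (4 + 4 * c ^ 2) * (j₁ ^ 2 + j₂ ^ 2)
      + 4 * G * (σ + τ) := by
    rw [p0] at Q₁; rw [r0] at Q₂
    linarith [sq_nonneg (j₁ - a), sq_nonneg (j₂ - b)]
  exact step_bound_arith hG sp sr (by positivity) (by positivity) energy weighted

lemma continuousOn_mul_eval_intervalIntegrable {w : ℝ → ℝ} {α β : ℝ} (hαβ : α ≤ β)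
    (hw : ContinuousOn w (Set.Icc α β)) (v : ℝ[X]) :
    IntervalIntegrable (fun s => w s * v.eval s) volume α β := by
  refine ContinuousOn.intervalIntegrable ?_
  rw [Set.uIcc_of_le hαβ]
  exact hw.mul v.continuous.continuousOn

/-- The functional `v ↦ w(1) v(1) - ∫₀¹ w (dv/ds)`. -/
def radauFunctional (w : ℝ → ℝ) (hw : ContinuousOn w (Set.Icc 0 1)) : ℝ[X] →ₗ[ℝ] ℝ where
  toFun v := w 1 * v.eval 1 - ∫ s in (0 : ℝ)..1, w s * (derivative v).eval s
  map_add' u v := by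
    simp only [eval_add, derivative_add, mul_add]
    rw [intervalIntegral.integral_add
      (continuousOn_mul_eval_intervalIntegrable zero_le_one hw _)
      (continuousOn_mul_eval_intervalIntegrable zero_le_one hw _)]
    ring
  map_smul' c v := by
    simp only [derivative_smul, eval_smul, smul_eq_mul, RingHom.id_apply, mul_left_comm _ c,
      intervalIntegral.integral_const_mul]
    ring

lemma radauFunctional_eval (p v : ℝ[X]) :
    radauFunctional (fun s => p.eval s) p.continuous.continuousOn v
      = unitIntegral (derivative p * v) + p.eval 0 * v.eval 0 := by
  have h := unitIntegral_derivative (p * v)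
  rw [derivative_mul, map_add] at h
  have h2 : unitIntegral (p * derivative v)
      = ∫ s in (0 : ℝ)..1, p.eval s * (derivative v).eval s := by
    simp [unitIntegral_apply]
  simp only [eval_mul] at h
  simp only [radauFunctional, LinearMap.coe_mk, AddHom.coe_mk]
  linarith

lemma radauFunctional_sub {w z : ℝ → ℝ} (hw : ContinuousOn w (Set.Icc 0 1))
    (hz : ContinuousOn z (Set.Icc 0 1)) (v : ℝ[X]) :
    radauFunctional (fun s => w s - z s) (hw.sub hz) v
      = radauFunctional w hw v - radauFunctional z hz v := by
  simp only [radauFunctional, LinearMap.coe_mk, AddHom.coe_mk, sub_mul]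
  rw [intervalIntegral.integral_sub
    (continuousOn_mul_eval_intervalIntegrable zero_le_one hw _)
    (continuousOn_mul_eval_intervalIntegrable zero_le_one hz _)]
  ring

lemma abs_unit_integral_mul_le {g : ℝ → ℝ} {v : ℝ[X]} {ε M : ℝ}
    (hg : ∀ t ∈ Set.Icc (0 : ℝ) 1, |g t| ≤ ε) (hv : ∀ t ∈ Set.Icc (0 : ℝ) 1, |v.eval t| ≤ M) :
    |∫ s in (0 : ℝ)..1, g s * v.eval s| ≤ ε * M := by
  have := intervalIntegral.norm_integral_le_of_norm_le_const
    (a := 0) (b := 1) (f := fun s => g s * v.eval s) (C := ε * M) (fun x hx => by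
      rw [Set.uIoc_of_le zero_le_one] at hx
      have hx' : x ∈ Set.Icc (0 : ℝ) 1 := Set.Ioc_subset_Icc_self hx
      rw [Real.norm_eq_abs, abs_mul]
      exact mul_le_mul (hg x hx') (hv x hx') (abs_nonneg _) ((abs_nonneg _).trans (hg x hx')))
  simpa using this

/-- The Radau projection onto polynomials of degree at most `q` exists and is quasi-optimal. -/
lemma exists_unit_radau_projection (q : ℕ) :
    ∃ K : ℝ, 0 < K ∧ ∀ (w : ℝ → ℝ) (hw : ContinuousOn w (Set.Icc 0 1)),
      ∃ P ∈ degreeLT ℝ (q + 1), P.eval 1 = w 1 ∧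
        (∀ v ∈ degreeLT ℝ (q + 1), unitIntegral (derivative P * v) + P.eval 0 * v.eval 0
          = radauFunctional w hw v) ∧
        ∀ Q ∈ degreeLT ℝ (q + 1), ∀ ε : ℝ, (∀ t ∈ Set.Icc (0 : ℝ) 1, |w t - Q.eval t| ≤ ε) →
          ∀ t ∈ Set.Icc (0 : ℝ) 1, |w t - P.eval t| ≤ K * ε := by
  obtain ⟨K, hK, hstab⟩ := exists_unit_step_stability (q + 1)
  obtain ⟨c, hc0, hc⟩ := exists_abs_eval_le_mul_unitNorm (q + 1) LinearMap.id fun p hp => hp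
  obtain ⟨d, hd0, hd⟩ := exists_abs_eval_le_mul_unitNorm (q + 1) derivative
    fun p hp => derivative_mem_degreeLT hp
  simp only [LinearMap.id_apply] at hc
  have key : ∀ D ∈ degreeLT ℝ (q + 1), ∀ G : ℝ, 0 ≤ G →
      (∀ v ∈ degreeLT ℝ (q + 1),
        |unitIntegral (derivative D * v) + D.eval 0 * v.eval 0| ≤ G * unitNorm v) →
      unitNorm D ≤ K * G := by
    intro D hD G hG h
    have := (hstab D hD 0 (Submodule.zero_mem _) 0 0 0 G hG _ (fun _ => 0) h
      (fun v _ => by simpa using mul_nonneg hG (unitNorm_nonneg v))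
      (fun v _ => by simp) (fun v _ => by simp)).2
    simpa using this
  have hone : (1 : ℝ[X]) ∈ degreeLT ℝ (q + 1) := by
    rw [mem_degreeLT, degree_one]
    exact_mod_cast Nat.succ_pos q
  have h1 : (1 : ℝ) ∈ Set.Icc (0 : ℝ) 1 := ⟨zero_le_one, le_rfl⟩
  refine ⟨1 + c * (K * (c + d)), by positivity, fun w hw => ?_⟩
  obtain ⟨P, hP, hPe⟩ := exists_bilin_eq_of_injective (degreeLT ℝ (q + 1))
    (((LinearMap.mul ℝ ℝ[X]).compr₂ unitIntegral).comp derivative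
      + (LinearMap.mul ℝ ℝ).compl₁₂ (leval 0) (leval 0))
    (fun u hu h => by
      simp only [LinearMap.add_apply, LinearMap.comp_apply, LinearMap.compr₂_apply,
        LinearMap.mul_apply', LinearMap.compl₁₂_apply, leval_apply] at h
      have := key u hu 0 le_rfl fun v hv => by rw [h v hv]; simp
      rw [mul_zero] at this
      apply eq_zero_of_unitIntegral_mul_self
      rw [← unitNorm_sq, le_antisymm this (unitNorm_nonneg u)]
      simp) (radauFunctional w hw)
  simp only [LinearMap.add_apply, LinearMap.comp_apply, LinearMap.compr₂_apply,
    LinearMap.mul_apply', LinearMap.compl₁₂_apply, leval_apply] at hPe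
  refine ⟨P, hP, ?_, hPe, ?_⟩
  · have := hPe 1 hone
    rw [mul_one, unitIntegral_derivative] at this
    simpa [radauFunctional] using this
  · intro Q hQ ε hε t ht
    have hε0 : 0 ≤ ε := (abs_nonneg _).trans (hε t ht)
    have hD := Submodule.sub_mem _ hP hQ
    have hb := key (P - Q) hD (ε * (c + d)) (by positivity) fun v hv => by
      have e : unitIntegral (derivative (P - Q) * v) + (P - Q).eval 0 * v.eval 0
          = radauFunctional (fun s => w s - Q.eval s) (hw.sub Q.continuous.continuousOn) v := by
        rw [radauFunctional_sub hw Q.continuous.continuousOn, ← hPe v hv, radauFunctional_eval]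
        simp only [sub_mul, map_sub, eval_sub]
        ring
      rw [e]
      simp only [radauFunctional, LinearMap.coe_mk, AddHom.coe_mk]
      have b1 := abs_unit_integral_mul_le hε (fun t ht => hd v hv t ht)
      have b2 : |(w 1 - Q.eval 1) * v.eval 1| ≤ ε * (c * unitNorm v) := by
        rw [abs_mul]
        exact mul_le_mul (hε 1 h1) (hc v hv 1 h1) (abs_nonneg _) hε0
      refine (abs_sub _ _).trans ?_
      linarith
    have hPQ := hc (P - Q) hD t ht
    have := mul_le_mul_of_nonneg_left hb hc0
    have tri : |w t - P.eval t| ≤ |w t - Q.eval t| + |(P - Q).eval t| := by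
      rw [eval_sub]
      have := abs_sub (w t - Q.eval t) (P.eval t - Q.eval t)
      rwa [sub_sub_sub_cancel_right] at this
    have := hε t ht
    nlinarith

/-- Error of one dG step on the unit interval. -/
lemma exists_unit_step_error (q : ℕ) :
    ∃ K : ℝ, 0 < K ∧ ∀ p ∈ degreeLT ℝ (q + 1), ∀ r ∈ degreeLT ℝ (q + 1),
      ∀ (x y : ℝ → ℝ), ContinuousOn x (Set.Icc 0 1) → ContinuousOn y (Set.Icc 0 1) →
      ∀ ω a b ε₁ ε₂ : ℝ,
      ∀ Q₁ ∈ degreeLT ℝ (q + 1), ∀ Q₂ ∈ degreeLT ℝ (q + 1),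
      (∀ t ∈ Set.Icc (0 : ℝ) 1, |x t - Q₁.eval t| ≤ ε₁) →
      (∀ t ∈ Set.Icc (0 : ℝ) 1, |y t - Q₂.eval t| ≤ ε₂) →
      (∀ v ∈ degreeLT ℝ (q + 1), unitIntegral (derivative p * v) - ω * unitIntegral (r * v)
        + (p.eval 0 - x 0 - a) * v.eval 0 = x 1 * v.eval 1 - x 0 * v.eval 0
          - (∫ s in (0 : ℝ)..1, x s * (derivative v).eval s)
          - ω * ∫ s in (0 : ℝ)..1, y s * v.eval s) →
      (∀ v ∈ degreeLT ℝ (q + 1), unitIntegral (derivative r * v) + ω * unitIntegral (p * v)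
        + (r.eval 0 - y 0 - b) * v.eval 0 = y 1 * v.eval 1 - y 0 * v.eval 0
          - (∫ s in (0 : ℝ)..1, y s * (derivative v).eval s)
          + ω * ∫ s in (0 : ℝ)..1, x s * v.eval s) →
      (p.eval 1 - x 1) ^ 2 + (r.eval 1 - y 1) ^ 2 ≤ a ^ 2 + b ^ 2
        + K * (|ω| * (ε₁ + ε₂)) * (|a| + |b| + |ω| * (ε₁ + ε₂)) := by
  obtain ⟨K, hK, hstab⟩ := exists_unit_step_stability (q + 1)
  obtain ⟨c, hc0, hc⟩ := exists_abs_eval_le_mul_unitNorm (q + 1) LinearMap.id fun p hp => hp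
  obtain ⟨L, hL, hproj⟩ := exists_unit_radau_projection q
  simp only [LinearMap.id_apply] at hc
  have h1 : (1 : ℝ) ∈ Set.Icc (0 : ℝ) 1 := ⟨zero_le_one, le_rfl⟩
  refine ⟨K * (L * c + 1) ^ 2, by positivity, ?_⟩
  intro p hp r hr x y hx hy ω a b ε₁ ε₂ Q₁ hQ₁ Q₂ hQ₂ hε₁ hε₂ h₁ h₂
  have hε₁0 : 0 ≤ ε₁ := (abs_nonneg _).trans (hε₁ 1 h1)
  have hε₂0 : 0 ≤ ε₂ := (abs_nonneg _).trans (hε₂ 1 h1)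
  obtain ⟨P₁, hP₁, hP₁1, hP₁e, hP₁b⟩ := hproj x hx
  obtain ⟨P₂, hP₂, hP₂1, hP₂e, hP₂b⟩ := hproj y hy
  specialize hP₁b Q₁ hQ₁ ε₁ hε₁
  specialize hP₂b Q₂ hQ₂ ε₂ hε₂
  have hω := abs_nonneg ω
  have bound : ∀ (z : ℝ → ℝ) (P : ℝ[X]) (ε ε' : ℝ), ε ≤ ε' → 0 ≤ ε' →
      (∀ t ∈ Set.Icc (0 : ℝ) 1, |z t - P.eval t| ≤ L * ε) → ∀ v ∈ degreeLT ℝ (q + 1),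
      |ω * ∫ s in (0 : ℝ)..1, (z s - P.eval s) * v.eval s|
        ≤ (L * c + 1) * (|ω| * ε') * unitNorm v := by
    intro z P ε ε' hεε hε' h v hv
    have hv0 := unitNorm_nonneg v
    rw [abs_mul]
    calc |ω| * |∫ s in (0 : ℝ)..1, (z s - P.eval s) * v.eval s|
        ≤ |ω| * ((L * ε) * (c * unitNorm v)) :=
          mul_le_mul_of_nonneg_left (abs_unit_integral_mul_le h (hc v hv)) hω
      _ ≤ |ω| * ((L * ε') * (c * unitNorm v)) := by gcongr
      _ = (L * c) * (|ω| * ε') * unitNorm v := by ring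
      _ ≤ (L * c + 1) * (|ω| * ε') * unitNorm v := by gcongr; linarith
  have split : ∀ (z : ℝ → ℝ) (_ : ContinuousOn z (Set.Icc 0 1)) (P v : ℝ[X]),
      ∫ s in (0 : ℝ)..1, (z s - P.eval s) * v.eval s
        = (∫ s in (0 : ℝ)..1, z s * v.eval s) - unitIntegral (P * v) := by
    intro z hz P v
    simp only [sub_mul, unitIntegral_apply, eval_mul]
    exact intervalIntegral.integral_sub
      (continuousOn_mul_eval_intervalIntegrable zero_le_one hz _)
      (continuousOn_mul_eval_intervalIntegrable zero_le_one P.continuous.continuousOn _)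
  have hG : 0 ≤ |ω| * (ε₁ + ε₂) := by positivity
  have hfin := (hstab (p - P₁) (Submodule.sub_mem _ hp hP₁) (r - P₂) (Submodule.sub_mem _ hr hP₂)
    ω a b ((L * c + 1) * (|ω| * (ε₁ + ε₂))) (by positivity)
    (fun v => -(ω * ∫ s in (0 : ℝ)..1, (y s - P₂.eval s) * v.eval s))
    (fun v => ω * ∫ s in (0 : ℝ)..1, (x s - P₁.eval s) * v.eval s)
    (fun v hv => by
      rw [abs_neg]
      exact bound y P₂ ε₂ _ (by linarith) (by linarith) hP₂b v hv)
    (fun v hv => bound x P₁ ε₁ _ (by linarith) (by linarith) hP₁b v hv)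
    (fun v hv => by
      have e := hP₁e v hv
      have e' := h₁ v hv
      simp only [radauFunctional, LinearMap.coe_mk, AddHom.coe_mk] at e
      rw [split y hy]
      simp only [sub_mul, map_sub, eval_sub] at e' ⊢
      linarith)
    (fun v hv => by
      have e := hP₂e v hv
      have e' := h₂ v hv
      simp only [radauFunctional, LinearMap.coe_mk, AddHom.coe_mk] at e
      rw [split x hx]
      simp only [sub_mul, map_sub, eval_sub] at e' ⊢
      linarith)).1
  rw [eval_sub, eval_sub, hP₁1, hP₂1] at hfin
  refine hfin.trans ?_
  generalize |ω| * (ε₁ + ε₂) = G at *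
  have hm : 1 ≤ L * c + 1 := by nlinarith
  generalize L * c + 1 = m at *
  have hab : 0 ≤ |a| + |b| := by positivity
  have : |a| + |b| + m * G ≤ m * (|a| + |b| + G) := by nlinarith
  have := mul_le_mul_of_nonneg_left this (by positivity : 0 ≤ K * (m * G))
  linarith

/-! ### One step on a general interval and time marching -/

lemma mem_degreeLT_succ_iff {q : ℕ} {p : ℝ[X]} :
    p ∈ degreeLT ℝ (q + 1) ↔ p.natDegree ≤ q := by
  rw [degreeLT_succ_eq_degreeLE, mem_degreeLE, natDegree_le_iff_degree_le]

lemma comp_linear_mem_degreeLT {q : ℕ} {p : ℝ[X]} (hp : p ∈ degreeLT ℝ (q + 1)) (k d : ℝ) :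
    p.comp (C k * X + C d) ∈ degreeLT ℝ (q + 1) := by
  rw [mem_degreeLT_succ_iff] at *
  calc _ ≤ p.natDegree * (C k * X + C d : ℝ[X]).natDegree := natDegree_comp_le
    _ ≤ p.natDegree * 1 := Nat.mul_le_mul_left _ natDegree_linear_le
    _ ≤ q := by simpa using hp

lemma integral_eq_mul_integral_unit {α β : ℝ} (h : α < β) (g : ℝ → ℝ) :
    ∫ t in α..β, g t = (β - α) * ∫ s in (0 : ℝ)..1, g ((β - α) * s + α) := by
  rw [intervalIntegral.integral_comp_mul_add g (sub_pos.2 h).ne']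
  have : β - α ≠ 0 := (sub_pos.2 h).ne'
  simp [this]

/-- Error of one dG step on an interval `[α, β]`. -/
lemma exists_step_error (q : ℕ) :
    ∃ K : ℝ, 0 < K ∧ ∀ α β : ℝ, α < β → ∀ p ∈ degreeLT ℝ (q + 1), ∀ r ∈ degreeLT ℝ (q + 1),
      ∀ (x y : ℝ → ℝ), ContinuousOn x (Set.Icc α β) → ContinuousOn y (Set.Icc α β) →
      ∀ ω a b ε₁ ε₂ : ℝ, 0 ≤ ω →
      ∀ Q₁ ∈ degreeLT ℝ (q + 1), ∀ Q₂ ∈ degreeLT ℝ (q + 1),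
      (∀ t ∈ Set.Icc α β, |x t - Q₁.eval t| ≤ ε₁) →
      (∀ t ∈ Set.Icc α β, |y t - Q₂.eval t| ≤ ε₂) →
      (∀ v ∈ degreeLT ℝ (q + 1), (∫ s in α..β, (derivative p).eval s * v.eval s)
          - ω * (∫ s in α..β, r.eval s * v.eval s)
          + (p.eval α - x α - a) * v.eval α = x β * v.eval β - x α * v.eval α
          - (∫ s in α..β, x s * (derivative v).eval s)
          - ω * ∫ s in α..β, y s * v.eval s) →
      (∀ v ∈ degreeLT ℝ (q + 1), (∫ s in α..β, (derivative r).eval s * v.eval s)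
          + ω * (∫ s in α..β, p.eval s * v.eval s)
          + (r.eval α - y α - b) * v.eval α = y β * v.eval β - y α * v.eval α
          - (∫ s in α..β, y s * (derivative v).eval s)
          + ω * ∫ s in α..β, x s * v.eval s) →
      (p.eval β - x β) ^ 2 + (r.eval β - y β) ^ 2 ≤ a ^ 2 + b ^ 2
        + K * (ω * (β - α) * (ε₁ + ε₂)) * (|a| + |b| + ω * (β - α) * (ε₁ + ε₂)) := by
  obtain ⟨K, hK, hstep⟩ := exists_unit_step_error q
  refine ⟨K, hK, ?_⟩
  intro α β hαβ p hp r hr x y hx hy ω a b ε₁ ε₂ hω Q₁ hQ₁ Q₂ hQ₂ hε₁ hε₂ h₁ h₂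
  have hk : 0 < β - α := sub_pos.2 hαβ
  set k := β - α with hkdef
  have hk0 : k ≠ 0 := hk.ne'
  have hmaps : Set.MapsTo (fun s => k * s + α) (Set.Icc 0 1) (Set.Icc α β) := by
    intro s hs
    constructor <;> nlinarith [hs.1, hs.2]
  have hcont : ContinuousOn (fun s => k * s + α) (Set.Icc (0 : ℝ) 1) := by fun_prop
  have e1 : k * 1 + α = β := by rw [hkdef]; ring
  have e0 : k * 0 + α = α := by ring
  have evc : ∀ (v : ℝ[X]) (s : ℝ), (v.comp (C k * X + C α)).eval s = v.eval (k * s + α) := by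
    intro v s; simp [eval_comp]
  have pull : ∀ (V : ℝ[X]) (s : ℝ),
      (V.comp (C k⁻¹ * X + C (-(k⁻¹ * α)))).eval (k * s + α) = V.eval s := by
    intro V s
    simp only [eval_comp, eval_add, eval_mul, eval_C, eval_X]
    congr 1
    field_simp
    ring
  have pull' : ∀ (V : ℝ[X]) (s : ℝ),
      k * (derivative (V.comp (C k⁻¹ * X + C (-(k⁻¹ * α))))).eval (k * s + α)
        = (derivative V).eval s := by
    intro V s
    have : derivative (V.comp (C k⁻¹ * X + C (-(k⁻¹ * α))))
        = C k⁻¹ * (derivative V).comp (C k⁻¹ * X + C (-(k⁻¹ * α))) := by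
      rw [derivative_comp]; simp
    rw [this, eval_mul, pull, eval_C, ← mul_assoc, mul_inv_cancel₀ hk0, one_mul]
  have dcomp : ∀ v : ℝ[X], ∀ s : ℝ, (derivative (v.comp (C k * X + C α))).eval s
      = k * (derivative v).eval (k * s + α) := by
    intro v s
    rw [derivative_comp, eval_mul, evc]; simp
  have trans : ∀ (p r : ℝ[X]) (x y : ℝ → ℝ) (ω a : ℝ),
      (∀ v ∈ degreeLT ℝ (q + 1), (∫ s in α..β, (derivative p).eval s * v.eval s)
          + ω * (∫ s in α..β, r.eval s * v.eval s)
          + (p.eval α - x α - a) * v.eval α = x β * v.eval β - x α * v.eval α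
          - (∫ s in α..β, x s * (derivative v).eval s)
          + ω * ∫ s in α..β, y s * v.eval s) →
      ∀ v ∈ degreeLT ℝ (q + 1),
        unitIntegral (derivative (p.comp (C k * X + C α)) * v)
          + ω * k * unitIntegral (r.comp (C k * X + C α) * v)
          + ((p.comp (C k * X + C α)).eval 0 - x (k * 0 + α) - a) * v.eval 0
        = x (k * 1 + α) * v.eval 1 - x (k * 0 + α) * v.eval 0
          - (∫ s in (0 : ℝ)..1, x (k * s + α) * (derivative v).eval s)
          + ω * k * ∫ s in (0 : ℝ)..1, y (k * s + α) * v.eval s := by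
    intro p r x y ω a h v hv
    have h := h _ (comp_linear_mem_degreeLT hv k⁻¹ (-(k⁻¹ * α)))
    simp only [integral_eq_mul_integral_unit hαβ, ← hkdef, pull] at h
    have v1 := pull v 1
    have v0 := pull v 0
    rw [e1] at v1
    rw [e0] at v0
    rw [v1, v0, ← intervalIntegral.integral_const_mul k, ← intervalIntegral.integral_const_mul k
      (fun s => x (k * s + α) * _)] at h
    simp only [mul_left_comm k (x _), pull'] at h
    simp only [unitIntegral_apply, eval_mul, dcomp, evc, e1, e0, mul_assoc] at h ⊢
    exact h
  have hG : |ω * k| = ω * k := abs_of_nonneg (by positivity)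
  have := hstep _ (comp_linear_mem_degreeLT hp k α) _ (comp_linear_mem_degreeLT hr k α)
    (fun s => x (k * s + α)) (fun s => y (k * s + α)) (hx.comp hcont hmaps) (hy.comp hcont hmaps)
    (ω * k) a b ε₁ ε₂ _ (comp_linear_mem_degreeLT hQ₁ k α) _ (comp_linear_mem_degreeLT hQ₂ k α)
    (fun t ht => by rw [evc]; exact hε₁ _ (hmaps ht))
    (fun t ht => by rw [evc]; exact hε₂ _ (hmaps ht))
    (fun v hv => by
      have := trans p r x y (-ω) a (fun v hv => by linarith [h₁ v hv]) v hv
      linarith)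
    (trans r p y x ω b h₂)
  simp only [evc, e1, hG] at this
  exact this

lemma step_recursion_arith {K G a b e : ℝ} (hK : 0 < K) (hG : 0 ≤ G) (he : 0 ≤ e)
    (h : a ^ 2 + b ^ 2 ≤ e ^ 2) :
    a ^ 2 + b ^ 2 + K * G * (|a| + |b| + G) ≤ (e + (K + 1) * G) ^ 2 := by
  have ha : |a| ≤ e := abs_le_of_sq_le_sq (by nlinarith) he
  have hb : |b| ≤ e := abs_le_of_sq_le_sq (by nlinarith) he
  have : K * G * (|a| + |b| + G) ≤ K * G * (e + e + G) := by gcongr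
  nlinarith [mul_nonneg he hG, sq_nonneg (K * G), mul_nonneg hK.le (sq_nonneg G), sq_nonneg G]

/-- Nodal error of the dG method for a harmonic oscillator with frequency `ω`. -/
lemma exists_oscillator_nodal_error (q : ℕ) :
    ∃ K : ℝ, 0 < K ∧ ∀ (N : ℕ) (tt : ℕ → ℝ), (∀ n < N, tt n < tt (n + 1)) →
      ∀ (p r : ℕ → ℝ[X]), (∀ n, p n ∈ degreeLT ℝ (q + 1)) → (∀ n, r n ∈ degreeLT ℝ (q + 1)) →
      ∀ (x y : ℝ → ℝ), (∀ n < N, ContinuousOn x (Set.Icc (tt n) (tt (n + 1)))) →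
      (∀ n < N, ContinuousOn y (Set.Icc (tt n) (tt (n + 1)))) →
      ∀ ω : ℝ, 0 ≤ ω → ∀ A B ε₁ ε₂ : ℕ → ℝ,
      A 0 = x (tt 0) → B 0 = y (tt 0) →
      (∀ n < N, A (n + 1) = (p (n + 1)).eval (tt (n + 1))) →
      (∀ n < N, B (n + 1) = (r (n + 1)).eval (tt (n + 1))) →
      (∀ n < N, ∃ Q ∈ degreeLT ℝ (q + 1), ∀ t ∈ Set.Icc (tt n) (tt (n + 1)),
        |x t - Q.eval t| ≤ ε₁ n) →
      (∀ n < N, ∃ Q ∈ degreeLT ℝ (q + 1), ∀ t ∈ Set.Icc (tt n) (tt (n + 1)),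
        |y t - Q.eval t| ≤ ε₂ n) →
      (∀ n < N, ∀ v ∈ degreeLT ℝ (q + 1),
        (∫ s in tt n..tt (n + 1), (derivative (p (n + 1))).eval s * v.eval s)
          - ω * (∫ s in tt n..tt (n + 1), (r (n + 1)).eval s * v.eval s)
          + ((p (n + 1)).eval (tt n) - A n) * v.eval (tt n)
        = x (tt (n + 1)) * v.eval (tt (n + 1)) - x (tt n) * v.eval (tt n)
          - (∫ s in tt n..tt (n + 1), x s * (derivative v).eval s)
          - ω * ∫ s in tt n..tt (n + 1), y s * v.eval s) →
      (∀ n < N, ∀ v ∈ degreeLT ℝ (q + 1),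
        (∫ s in tt n..tt (n + 1), (derivative (r (n + 1))).eval s * v.eval s)
          + ω * (∫ s in tt n..tt (n + 1), (p (n + 1)).eval s * v.eval s)
          + ((r (n + 1)).eval (tt n) - B n) * v.eval (tt n)
        = y (tt (n + 1)) * v.eval (tt (n + 1)) - y (tt n) * v.eval (tt n)
          - (∫ s in tt n..tt (n + 1), y s * (derivative v).eval s)
          + ω * ∫ s in tt n..tt (n + 1), x s * v.eval s) →
      (A N - x (tt N)) ^ 2 + (B N - y (tt N)) ^ 2
        ≤ (K * ∑ n ∈ Finset.range N, ω * (tt (n + 1) - tt n) * (ε₁ n + ε₂ n)) ^ 2 := by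
  obtain ⟨K, hK, hstep⟩ := exists_step_error q
  refine ⟨K + 1, by linarith, ?_⟩
  intro N tt htt p r hp hr x y hx hy ω hω A B ε₁ ε₂ hA0 hB0 hA hB hQ₁ hQ₂ h₁ h₂
  have hG : ∀ n < N, 0 ≤ ω * (tt (n + 1) - tt n) * (ε₁ n + ε₂ n) := by
    intro n hn
    obtain ⟨Q₁, -, hb₁⟩ := hQ₁ n hn
    obtain ⟨Q₂, -, hb₂⟩ := hQ₂ n hn
    have hm : tt n ∈ Set.Icc (tt n) (tt (n + 1)) := ⟨le_rfl, (htt n hn).le⟩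
    have := (abs_nonneg _).trans (hb₁ _ hm)
    have := (abs_nonneg _).trans (hb₂ _ hm)
    have := (sub_pos.2 (htt n hn)).le
    positivity
  have main : ∀ m ≤ N, (A m - x (tt m)) ^ 2 + (B m - y (tt m)) ^ 2
      ≤ ((K + 1) * ∑ n ∈ Finset.range m, ω * (tt (n + 1) - tt n) * (ε₁ n + ε₂ n)) ^ 2 := by
    intro m
    induction m with
    | zero => intro _; simp [hA0, hB0]
    | succ m ih =>
      intro hm
      have hmN : m < N := hm
      obtain ⟨Q₁, hQ₁m, hb₁⟩ := hQ₁ m hmN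
      obtain ⟨Q₂, hQ₂m, hb₂⟩ := hQ₂ m hmN
      rw [hA m hmN, hB m hmN, Finset.sum_range_succ, mul_add]
      refine (hstep _ _ (htt m hmN) _ (hp (m + 1)) _ (hr (m + 1)) x y (hx m hmN) (hy m hmN) ω
        (A m - x (tt m)) (B m - y (tt m)) (ε₁ m) (ε₂ m) hω Q₁ hQ₁m Q₂ hQ₂m hb₁ hb₂
        (fun v hv => ?_) (fun v hv => ?_)).trans
        (step_recursion_arith hK (hG m hmN) ?_ (ih hmN.le))
      · rw [← h₁ m hmN v hv]; ring
      · rw [← h₂ m hmN v hv]; ring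
      · exact mul_nonneg (by linarith) (Finset.sum_nonneg fun n hn =>
          hG n ((Finset.mem_range.1 hn).trans hmN))
  exact main N le_rfl

/-! ### Polynomial approximation -/

lemma exists_derivative_eq {n : ℕ} {p : ℝ[X]} (hp : p ∈ degreeLT ℝ n) :
    ∃ P ∈ degreeLT ℝ (n + 1), derivative P = p := by
  refine ⟨∑ i ∈ Finset.range n, monomial (i + 1) (p.coeff i / (i + 1)),
    Submodule.sum_mem _ fun i hi => ?_, ?_⟩
  · rw [mem_degreeLT_succ_iff]
    exact (natDegree_monomial_le _).trans (Finset.mem_range.1 hi)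
  · rw [derivative_sum]
    ext j
    rw [finsetSum_coeff]
    simp only [derivative_monomial, coeff_monomial, Nat.add_sub_cancel, Finset.sum_ite_eq',
      Finset.mem_range]
    split_ifs with hj
    · push_cast
      field_simp
    · exact (coeff_eq_zero_of_degree_lt ((mem_degreeLT.1 hp).trans_le
        (by exact_mod_cast not_lt.1 hj))).symm

lemma exists_approx_Ioo {α β : ℝ} (hαβ : α < β) (q : ℕ) :
    ∀ D : ℕ → ℝ → ℝ,
      (∀ m < q + 1, ∀ t ∈ Set.Ioo α β, HasDerivAt (D m) (D (m + 1) t) t) →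
      IntervalIntegrable (D (q + 1)) volume α β →
      ∃ Q ∈ degreeLT ℝ (q + 1), ∀ t ∈ Set.Ioo α β,
        |D 0 t - Q.eval t| ≤ (β - α) ^ q * ∫ s in α..β, |D (q + 1) s| := by
  have hk : 0 < β - α := sub_pos.2 hαβ
  have hm : (α + β) / 2 ∈ Set.Ioo α β := ⟨by linarith, by linarith⟩
  induction q with
  | zero =>
    intro D hD hint
    refine ⟨C (D 0 ((α + β) / 2)), by simp [mem_degreeLT_succ_iff], fun t ht => ?_⟩
    have hsub : Set.uIcc ((α + β) / 2) t ⊆ Set.Ioo α β :=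
      Set.ordConnected_Ioo.uIcc_subset hm ht
    have hsub' : Set.uIcc ((α + β) / 2) t ⊆ Set.uIcc α β := by
      rw [Set.uIcc_of_le hαβ.le]; exact hsub.trans Set.Ioo_subset_Icc_self
    have hftc := intervalIntegral.integral_eq_sub_of_hasDerivAt
      (fun s hs => hD 0 zero_lt_one s (hsub hs)) (hint.mono_set hsub')
    rw [eval_C, ← hftc, pow_zero, one_mul, ← Real.norm_eq_abs]
    refine intervalIntegral.norm_integral_le_integral_norm_uIoc.trans ?_
    rw [intervalIntegral.integral_of_le hαβ.le]
    refine setIntegral_mono_set ?_ (Filter.Eventually.of_forall fun _ => norm_nonneg _) ?_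
    · exact ((intervalIntegrable_iff_integrableOn_Ioc_of_le hαβ.le).1 hint).norm
    · refine Filter.Eventually.of_forall fun s hs => ?_
      exact Set.Ioo_subset_Ioc_self (hsub (Set.uIoc_subset_uIcc hs))
  | succ q ih =>
    intro D hD hint
    obtain ⟨R, hR, hRb⟩ := ih (fun m => D (m + 1))
      (fun m hm t ht => hD (m + 1) (by omega) t ht) hint
    obtain ⟨P, hP, hPR⟩ := exists_derivative_eq hR
    refine ⟨P + C (D 0 ((α + β) / 2) - P.eval ((α + β) / 2)),
      Submodule.add_mem _ hP (by simp [mem_degreeLT_succ_iff]), fun t ht => ?_⟩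
    have := Convex.norm_image_sub_le_of_norm_hasDerivWithin_le
      (f := fun t => D 0 t - P.eval t) (f' := fun t => D 1 t - R.eval t)
      (fun s hs => ((hD 0 (by omega) s hs).sub (hPR ▸ P.hasDerivAt s)).hasDerivWithinAt)
      (fun s hs => hRb s hs) (convex_Ioo α β) hm ht
    rw [eval_add, eval_C]
    have hI : 0 ≤ ∫ s in α..β, |D (q + 1 + 1) s| :=
      intervalIntegral.integral_nonneg hαβ.le fun s _ => abs_nonneg _
    have hd : ‖t - (α + β) / 2‖ ≤ β - α := by
      rw [Real.norm_eq_abs, abs_le]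
      constructor <;> linarith [ht.1, ht.2]
    calc |D 0 t - (P.eval t + (D 0 ((α + β) / 2) - P.eval ((α + β) / 2)))|
        = ‖D 0 t - P.eval t - (D 0 ((α + β) / 2) - P.eval ((α + β) / 2))‖ := by
          rw [Real.norm_eq_abs]; congr 1; ring
      _ ≤ _ := this
      _ ≤ ((β - α) ^ q * ∫ s in α..β, |D (q + 1 + 1) s|) * (β - α) := by gcongr
      _ = _ := by ring

/-- Taylor approximation with the remainder controlled by the integral of the last derivative. -/
lemma exists_approx_Icc {α β : ℝ} (hαβ : α < β) (q : ℕ) (D : ℕ → ℝ → ℝ)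
    (hc : ContinuousOn (D 0) (Set.Icc α β))
    (hD : ∀ m < q + 1, ∀ t ∈ Set.Ioo α β, HasDerivAt (D m) (D (m + 1) t) t)
    (hint : IntervalIntegrable (D (q + 1)) volume α β) :
    ∃ Q ∈ degreeLT ℝ (q + 1), ∀ t ∈ Set.Icc α β,
      |D 0 t - Q.eval t| ≤ (β - α) ^ q * ∫ s in α..β, |D (q + 1) s| := by
  obtain ⟨Q, hQ, hb⟩ := exists_approx_Ioo hαβ q D hD hint
  refine ⟨Q, hQ, fun t ht => ?_⟩
  rw [← closure_Ioo hαβ.ne] at ht hc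
  exact le_on_closure hb (hc.sub Q.continuous.continuousOn).abs continuousOn_const ht

/-! ### Reduction of the dG equations to a single mode -/

section Mode

variable {H : Type*} [NormedAddCommGroup H] [InnerProductSpace ℝ H]

/-- The polynomial `s ↦ (pval q c n s, e)`. -/
def modePoly (q : ℕ) (c : ℕ → ℕ → H) (e : H) (n : ℕ) : ℝ[X] :=
  ∑ j ∈ Finset.range (q + 1), C ⟪c n j, e⟫ * X ^ j

lemma modePoly_mem (q : ℕ) (c : ℕ → ℕ → H) (e : H) (n : ℕ) :
    modePoly q c e n ∈ degreeLT ℝ (q + 1) := by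
  refine Submodule.sum_mem _ fun j hj => ?_
  rw [mem_degreeLT_succ_iff]
  exact (natDegree_C_mul_X_pow_le _ _).trans (Nat.lt_succ_iff.1 (Finset.mem_range.1 hj))

lemma inner_pval (q : ℕ) (c : ℕ → ℕ → H) (e : H) (n : ℕ) (s : ℝ) :
    ⟪pval q c n s, e⟫ = (modePoly q c e n).eval s := by
  simp only [pval, modePoly, sum_inner, real_inner_smul_left, eval_finsetSum, eval_mul, eval_C,
    eval_pow, eval_X]
  exact Finset.sum_congr rfl fun j _ => mul_comm _ _

lemma inner_pderiv (q : ℕ) (c : ℕ → ℕ → H) (e : H) (n : ℕ) (s : ℝ) :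
    ⟪pderiv q c n s, e⟫ = (derivative (modePoly q c e n)).eval s := by
  simp only [pderiv, modePoly, sum_inner, real_inner_smul_left, derivative_sum, eval_finsetSum,
    derivative_C_mul_X_pow, eval_mul, eval_C, eval_pow, eval_X]
  exact Finset.sum_congr rfl fun j _ => by ring

/-- Coefficients of the test function equal to `V(s) • e` on the `m`-th interval and vanishing on
the others. -/
def modeTest (e : H) (m : ℕ) (V : ℝ[X]) (n j : ℕ) : H :=
  if n = m then V.coeff j • e else 0

lemma pval_modeTest_self {q : ℕ} (e : H) (m : ℕ) {V : ℝ[X]} (hV : V ∈ degreeLT ℝ (q + 1))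
    (s : ℝ) : pval q (modeTest e m V) m s = V.eval s • e := by
  simp only [pval, modeTest, if_true, smul_smul, ← Finset.sum_smul]
  rw [eval_eq_sum_range' (Nat.lt_succ_iff.2 (mem_degreeLT_succ_iff.1 hV))]
  congr 1
  exact Finset.sum_congr rfl fun j _ => mul_comm _ _

lemma pval_modeTest_of_ne (q : ℕ) (e : H) {m n : ℕ} (h : n ≠ m) (V : ℝ[X]) (s : ℝ) :
    pval q (modeTest e m V) n s = 0 := by
  simp [pval, modeTest, h]

lemma aForm_smul_basis {φ : ℕ → H} (hφ : Orthonormal ℝ φ) (lam : ℕ → ℝ) (u : H) (k : ℕ) (c : ℝ) :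
    aForm φ lam u (c • φ k) = lam k * ⟪u, φ k⟫ * c := by
  rw [aForm, aPow, tsum_eq_single k]
  · rw [Real.rpow_one, real_inner_smul_left, real_inner_self_eq_norm_sq, hφ.1 k]
    ring
  · intro j hj
    rw [real_inner_smul_left, hφ.2 hj.symm]
    ring

lemma aForm_zero_right (φ : ℕ → H) (lam : ℕ → ℝ) (u : H) : aForm φ lam u 0 = 0 := by
  simp [aForm, aPow]

lemma memHs_smul_basis {φ : ℕ → H} (hφ : Orthonormal ℝ φ) (lam : ℕ → ℝ) (α : ℝ) (k : ℕ) (c : ℝ) :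
    MemHs φ lam α (c • φ k) := by
  refine summable_of_ne_finset_zero (s := {k}) fun j hj => ?_
  rw [real_inner_smul_left, hφ.2 (by simpa [eq_comm] using hj)]
  ring

lemma memHs_modeTest {φ : ℕ → H} (hφ : Orthonormal ℝ φ) (lam : ℕ → ℝ) (α : ℝ) (k m : ℕ)
    (V : ℝ[X]) (n j : ℕ) : MemHs φ lam α (modeTest (φ k) m V n j) := by
  unfold modeTest
  split_ifs
  · exact memHs_smul_basis hφ lam α k _
  · simpa using memHs_smul_basis hφ lam α k 0

lemma Bform_modeTest {φ : ℕ → H} (hφ : Orthonormal ℝ φ) (lam : ℕ → ℝ) (tt : ℕ → ℝ) {N q : ℕ}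
    (c1 c2 : ℕ → ℕ → H) (k : ℕ) {l : ℕ} (hl : l < N) {V₁ V₂ : ℝ[X]}
    (hV₁ : V₁ ∈ degreeLT ℝ (q + 1)) (hV₂ : V₂ ∈ degreeLT ℝ (q + 1)) :
    Bform φ lam tt N q c1 c2 (modeTest (φ k) (l + 1) V₁) (modeTest (φ k) (l + 1) V₂)
      = (∫ s in tt l..tt (l + 1),
          (lam k * (derivative (modePoly q c1 (φ k) (l + 1))).eval s * V₁.eval s
            - lam k * (modePoly q c2 (φ k) (l + 1)).eval s * V₁.eval s
            + (derivative (modePoly q c2 (φ k) (l + 1))).eval s * V₂.eval s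
            + lam k * (modePoly q c1 (φ k) (l + 1)).eval s * V₂.eval s))
        + lam k * ((modePoly q c1 (φ k) (l + 1)).eval (tt l)
            - if l = 0 then 0 else (modePoly q c1 (φ k) l).eval (tt l)) * V₁.eval (tt l)
        + ((modePoly q c2 (φ k) (l + 1)).eval (tt l)
            - if l = 0 then 0 else (modePoly q c2 (φ k) l).eval (tt l)) * V₂.eval (tt l) := by
  unfold Bform
  rw [Finset.sum_eq_single_of_mem (l + 1) (Finset.mem_Icc.2 ⟨by omega, hl⟩)
    (fun n _ hn => by
      simp only [pval_modeTest_of_ne q (φ k) hn, aForm_zero_right, inner_zero_right]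
      simp)]
  simp only [Nat.add_sub_cancel, pval_modeTest_self (φ k) (l + 1) hV₁,
    pval_modeTest_self (φ k) (l + 1) hV₂, aForm_smul_basis hφ, real_inner_smul_right,
    fun c => inner_pval q c (φ k), inner_pderiv, mul_comm (V₂.eval _)]
  rcases Nat.eq_zero_or_pos l with rfl | hpos
  · rw [Finset.sum_eq_zero (fun n hn => by
      have hn1 := (Finset.mem_Icc.1 hn).1
      have : n + 1 ≠ 0 + 1 := by omega
      simp only [pval_modeTest_of_ne q (φ k) this, aForm_zero_right, inner_zero_right, add_zero])]
    simp only [zero_add, pval_modeTest_self (φ k) 1 hV₁,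
      pval_modeTest_self (φ k) 1 hV₂, aForm_smul_basis hφ, real_inner_smul_right,
      inner_pval, if_true]
    ring
  · have h1 : 1 ≠ l + 1 := by omega
    rw [Finset.sum_eq_single_of_mem l (Finset.mem_Icc.2 ⟨hpos, by omega⟩) (fun n _ hn => by
      have : n + 1 ≠ l + 1 := by omega
      simp only [pval_modeTest_of_ne q (φ k) this, aForm_zero_right, inner_zero_right, add_zero])]
    simp only [pval_modeTest_of_ne q (φ k) h1, aForm_zero_right, inner_zero_right,
      pval_modeTest_self (φ k) (l + 1) hV₁, pval_modeTest_self (φ k) (l + 1) hV₂,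
      aForm_smul_basis hφ, real_inner_smul_right, inner_sub_left, inner_pval, hpos.ne', if_false]
    ring

lemma load_modeTest {φ : ℕ → H} (hφ : Orthonormal ℝ φ) (lam : ℕ → ℝ) (tt : ℕ → ℝ) {N q : ℕ}
    (f : ℝ → H) (u0 v0 : H) (k : ℕ) {l : ℕ} (hl : l < N) {V₁ V₂ : ℝ[X]}
    (hV₁ : V₁ ∈ degreeLT ℝ (q + 1)) (hV₂ : V₂ ∈ degreeLT ℝ (q + 1)) :
    (∑ n ∈ Finset.Icc 1 N, ∫ s in tt (n-1)..tt n, ⟪f s, pval q (modeTest (φ k) (l + 1) V₂) n s⟫)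
      + aForm φ lam u0 (pval q (modeTest (φ k) (l + 1) V₁) 1 (tt 0))
      + ⟪v0, pval q (modeTest (φ k) (l + 1) V₂) 1 (tt 0)⟫
    = (∫ s in tt l..tt (l + 1), ⟪f s, φ k⟫ * V₂.eval s)
      + lam k * (if l = 0 then ⟪u0, φ k⟫ else 0) * V₁.eval (tt l)
      + (if l = 0 then ⟪v0, φ k⟫ else 0) * V₂.eval (tt l) := by
  rw [Finset.sum_eq_single_of_mem (l + 1) (Finset.mem_Icc.2 ⟨by omega, hl⟩)
    (fun n _ hn => by
      simp only [pval_modeTest_of_ne q (φ k) hn, inner_zero_right]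
      simp)]
  simp only [Nat.add_sub_cancel, pval_modeTest_self (φ k) (l + 1) hV₂, real_inner_smul_right,
    mul_comm (V₂.eval _)]
  rcases Nat.eq_zero_or_pos l with rfl | hpos
  · simp only [zero_add, pval_modeTest_self (φ k) 1 hV₁,
      pval_modeTest_self (φ k) 1 hV₂, aForm_smul_basis hφ, real_inner_smul_right, if_true]
    ring
  · have h1 : 1 ≠ l + 1 := by omega
    simp only [pval_modeTest_of_ne q (φ k) h1, aForm_zero_right, inner_zero_right, hpos.ne',
      if_false]
    ring

/-- The left limits at the nodes of a mode of the discrete solution, with initial value `z`. -/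
def modeNodal (q : ℕ) (c : ℕ → ℕ → H) (e : H) (tt : ℕ → ℝ) (z : ℝ) (n : ℕ) : ℝ :=
  if n = 0 then z else (modePoly q c e n).eval (tt n)

/-- The dG equations for a single mode on a single interval. -/
lemma mode_equations {φ : ℕ → H} (hφ : Orthonormal ℝ φ) {lam : ℕ → ℝ} {tt : ℕ → ℝ} {N q : ℕ}
    {c1 c2 : ℕ → ℕ → H} {f : ℝ → H} {u0 v0 : H}
    (h : ∀ d1 d2 : ℕ → ℕ → H, (∀ n j, MemHs φ lam 1 (d1 n j)) →
        (∀ n j, MemHs φ lam 1 (d2 n j)) →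
        Bform φ lam tt N q c1 c2 d1 d2 =
          (∑ n ∈ Finset.Icc 1 N, ∫ s in tt (n-1)..tt n, ⟪f s, pval q d2 n s⟫)
            + aForm φ lam u0 (pval q d1 1 (tt 0)) + ⟪v0, pval q d2 1 (tt 0)⟫)
    {k : ℕ} (hk : 0 < lam k) {l : ℕ} (hl : l < N) {V : ℝ[X]} (hV : V ∈ degreeLT ℝ (q + 1)) :
    ((∫ s in tt l..tt (l + 1), (derivative (modePoly q c1 (φ k) (l + 1))).eval s * V.eval s)
        - (∫ s in tt l..tt (l + 1), (modePoly q c2 (φ k) (l + 1)).eval s * V.eval s)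
        + ((modePoly q c1 (φ k) (l + 1)).eval (tt l)
            - modeNodal q c1 (φ k) tt ⟪u0, φ k⟫ l) * V.eval (tt l) = 0) ∧
    ((∫ s in tt l..tt (l + 1), (derivative (modePoly q c2 (φ k) (l + 1))).eval s * V.eval s)
        + lam k * (∫ s in tt l..tt (l + 1), (modePoly q c1 (φ k) (l + 1)).eval s * V.eval s)
        + ((modePoly q c2 (φ k) (l + 1)).eval (tt l)
            - modeNodal q c2 (φ k) tt ⟪v0, φ k⟫ l) * V.eval (tt l)
      = ∫ s in tt l..tt (l + 1), ⟪f s, φ k⟫ * V.eval s) := by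
  have hmem : ∀ W n j, MemHs φ lam 1 (modeTest (φ k) (l + 1) W n j) :=
    fun W n j => memHs_modeTest hφ lam 1 k (l + 1) W n j
  have hz : (0 : ℝ[X]) ∈ degreeLT ℝ (q + 1) := Submodule.zero_mem _
  have nodal : ∀ c z, modeNodal q c (φ k) tt z l
      = (if l = 0 then 0 else (modePoly q c (φ k) l).eval (tt l)) + if l = 0 then z else 0 := by
    intro c z
    unfold modeNodal
    split_ifs <;> simp
  have hint : ∀ p r : ℝ[X], IntervalIntegrable (fun s => p.eval s * r.eval s) volume
      (tt l) (tt (l + 1)) := fun p r =>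
    (p.continuous.mul r.continuous).intervalIntegrable _ _
  rw [nodal, nodal]
  constructor
  · have e := h _ _ (hmem V) (hmem 0)
    rw [Bform_modeTest hφ lam tt c1 c2 k hl hV hz, load_modeTest hφ lam tt f u0 v0 k hl hV hz] at e
    simp only [eval_zero, mul_zero, add_zero, mul_assoc, ← mul_sub,
      intervalIntegral.integral_const_mul, intervalIntegral.integral_zero, zero_add] at e
    rw [← mul_add] at e
    have e := mul_left_cancel₀ hk.ne' e
    rw [intervalIntegral.integral_sub (hint _ _) (hint _ _)] at e
    rw [← sub_sub, sub_mul _ (ite _ _ _), ← e]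
    ring
  · have e := h _ _ (hmem 0) (hmem V)
    rw [Bform_modeTest hφ lam tt c1 c2 k hl hz hV, load_modeTest hφ lam tt f u0 v0 k hl hz hV] at e
    simp only [eval_zero, mul_zero, add_zero, mul_assoc, sub_zero, zero_add] at e
    rw [intervalIntegral.integral_add (hint _ _) ((hint _ _).const_mul _),
      intervalIntegral.integral_const_mul] at e
    linarith

end Mode

/-! ### Modes of the exact solution -/

section Exact

variable {H : Type*} [NormedAddCommGroup H] [InnerProductSpace ℝ H]

lemma hasDerivAt_inner_const {u : ℝ → H} {u' : H} {t : ℝ} (h : HasDerivAt u u' t) (e : H) :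
    HasDerivAt (fun s => ⟪u s, e⟫) ⟪u', e⟫ t := by
  simpa using h.inner ℝ (hasDerivAt_const t e)

lemma inner_Aop [CompleteSpace H] {φ : ℕ → H} (hφ : Orthonormal ℝ φ) {lam : ℕ → ℝ} {u : H}
    (hu : MemHs φ lam 2 u) (k : ℕ) : ⟪Aop φ lam u, φ k⟫ = lam k * ⟪u, φ k⟫ := by
  have hs : Summable fun j => (lam j * ⟪u, φ j⟫) • φ j := by
    have := (hφ.orthogonalFamily.summable_iff_norm_sq_summable
      (fun j => lam j * ⟪u, φ j⟫)).2 (by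
        refine Summable.congr hu fun j => ?_
        rw [Real.norm_eq_abs, sq_abs, mul_pow]
        norm_num)
    simpa using this
  rw [Aop, real_inner_comm, ← innerSL_apply_apply ℝ, (innerSL ℝ (φ k)).map_tsum hs,
    tsum_eq_single k]
  · rw [innerSL_apply_apply, real_inner_smul_right, real_inner_self_eq_norm_sq, hφ.1 k]
    ring
  · intro j hj
    rw [innerSL_apply_apply, real_inner_smul_right, hφ.2 hj.symm, mul_zero]

lemma integral_mul_eval_eq {x g : ℝ → ℝ} {α β : ℝ} (hαβ : α ≤ β)
    (hx : ContinuousOn x (Set.Icc α β)) (hd : ∀ t ∈ Set.Ioo α β, HasDerivAt x (g t) t)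
    (hg : IntervalIntegrable g volume α β) (v : ℝ[X]) :
    ∫ s in α..β, g s * v.eval s = x β * v.eval β - x α * v.eval α
      - ∫ s in α..β, x s * (derivative v).eval s := by
  have h1 : IntervalIntegrable (fun s => g s * v.eval s) volume α β :=
    hg.mul_continuousOn v.continuous.continuousOn
  have h2 := continuousOn_mul_eval_intervalIntegrable hαβ hx (derivative v)
  have := intervalIntegral.integral_eq_sub_of_hasDerivAt_of_le hαβ
    (hx.mul v.continuous.continuousOn) (fun t ht => (hd t ht).mul (v.hasDerivAt t)) (h1.add h2)
  rw [intervalIntegral.integral_add h1 h2] at this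
  simp only [Pi.mul_apply] at this
  linarith

lemma mesh_le {tt : ℕ → ℝ} {N : ℕ} (h : ∀ n < N, tt n < tt (n + 1)) {i j : ℕ} (hij : i ≤ j)
    (hj : j ≤ N) : tt i ≤ tt j := by
  induction j, hij using Nat.le_induction with
  | base => exact le_rfl
  | succ j _ ih => exact (ih (by omega)).trans (h j (by omega)).le

/-- A finite partial sum of the series of `‖v‖_α²`, with weights `w_k² = λ_k^α`. -/
lemma sqrt_sum_le_hsNorm {φ : ℕ → H} {lam : ℕ → ℝ} (hlam : ∀ k, 0 < lam k) {α : ℝ} {w : ℕ → ℝ}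
    (hw : ∀ k, w k ^ 2 = lam k ^ α) {v : H} (hv : MemHs φ lam α v) (S : Finset ℕ) :
    √(∑ k ∈ S, (w k * |⟪v, φ k⟫|) ^ 2) ≤ hsNorm φ lam α v := by
  refine Real.sqrt_le_sqrt ?_
  simp only [mul_pow, sq_abs, hw]
  exact hv.sum_le_tsum S fun k _ => mul_nonneg (Real.rpow_nonneg (hlam k).le _) (sq_nonneg _)

lemma mul_abs_inner_le_hsNorm {φ : ℕ → H} {lam : ℕ → ℝ} (hlam : ∀ k, 0 < lam k) {α : ℝ}
    {w : ℕ → ℝ} (hw : ∀ k, w k ^ 2 = lam k ^ α) (hw0 : ∀ k, 0 < w k) {v : H}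
    (hv : MemHs φ lam α v) (k : ℕ) : w k * |⟪v, φ k⟫| ≤ hsNorm φ lam α v := by
  have h := sqrt_sum_le_hsNorm hlam hw hv {k}
  rwa [Finset.sum_singleton, Real.sqrt_sq (mul_nonneg (hw0 k).le (abs_nonneg _))] at h

lemma intervalIntegrable_inner_iteratedDeriv [CompleteSpace H] {φ : ℕ → H} {lam : ℕ → ℝ}
    (hlam : ∀ k, 0 < lam k) {α : ℝ} {w : ℕ → ℝ} (hw : ∀ k, w k ^ 2 = lam k ^ α)
    (hw0 : ∀ k, 0 < w k) {u : ℝ → H} {q : ℕ} {T : ℝ}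
    (hu : ∀ t, MemHs φ lam α (iteratedDeriv (q + 1) u t))
    (hint : IntervalIntegrable (fun t => hsNorm φ lam α (iteratedDeriv (q + 1) u t)) volume 0 T)
    (k : ℕ) :
    IntervalIntegrable (fun t => ⟪iteratedDeriv (q + 1) u t, φ k⟫) volume 0 T := by
  refine (hint.const_mul (w k)⁻¹).mono_fun ?_ (Filter.Eventually.of_forall fun t => ?_)
  · rw [iteratedDeriv_succ]
    exact (aestronglyMeasurable_deriv _ _).inner aestronglyMeasurable_const
  · have h := mul_abs_inner_le_hsNorm hlam hw hw0 (hu t) k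
    have : |⟪iteratedDeriv (q + 1) u t, φ k⟫|
        ≤ (w k)⁻¹ * hsNorm φ lam α (iteratedDeriv (q + 1) u t) := by
      rwa [le_inv_mul_iff₀ (hw0 k)]
    exact this.trans (le_abs_self _)

/-- Nodal error of a single mode. -/
lemma exists_mode_nodal_error [CompleteSpace H] (φ : ℕ → H) (lam : ℕ → ℝ) (hφ : Orthonormal ℝ φ)
    (hlam_pos : ∀ k, 0 < lam k) (q : ℕ) :
    ∃ K : ℝ, 0 < K ∧ ∀ (T : ℝ) (N : ℕ), 1 ≤ N →
      ∀ tt : ℕ → ℝ, tt 0 = 0 → tt N = T → (∀ n < N, tt n < tt (n + 1)) →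
      ∀ f : ℝ → H, IntervalIntegrable f volume 0 T →
      ∀ u1 u2 : ℝ → H,
      ContinuousOn u1 (Set.Icc 0 T) → ContinuousOn u2 (Set.Icc 0 T) →
      (∀ t, MemHs φ lam 2 (u1 t)) →
      (∀ t ∈ Set.Ioo 0 T, HasDerivAt u1 (u2 t) t) →
      (∀ t ∈ Set.Ioo 0 T, HasDerivAt u2 (f t - Aop φ lam (u1 t)) t) →
      (∀ m < q + 1, ∀ t ∈ Set.Ioo 0 T,
        HasDerivAt (iteratedDeriv m u1) (iteratedDeriv (m+1) u1 t) t) →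
      (∀ m < q + 1, ∀ t ∈ Set.Ioo 0 T,
        HasDerivAt (iteratedDeriv m u2) (iteratedDeriv (m+1) u2 t) t) →
      ∀ k : ℕ,
      IntervalIntegrable (fun t => ⟪iteratedDeriv (q + 1) u1 t, φ k⟫) volume 0 T →
      IntervalIntegrable (fun t => ⟪iteratedDeriv (q + 1) u2 t, φ k⟫) volume 0 T →
      ∀ c1 c2 : ℕ → ℕ → H,
      (∀ d1 d2 : ℕ → ℕ → H, (∀ n j, MemHs φ lam 1 (d1 n j)) →
        (∀ n j, MemHs φ lam 1 (d2 n j)) →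
        Bform φ lam tt N q c1 c2 d1 d2 =
          (∑ n ∈ Finset.Icc 1 N, ∫ s in tt (n-1)..tt n, ⟪f s, pval q d2 n s⟫)
            + aForm φ lam (u1 0) (pval q d1 1 (tt 0)) + ⟪u2 0, pval q d2 1 (tt 0)⟫) →
      lam k * ⟪pval q c1 N (tt N) - u1 (tt N), φ k⟫ ^ 2
          + ⟪pval q c2 N (tt N) - u2 (tt N), φ k⟫ ^ 2
        ≤ (K * ∑ n ∈ Finset.Icc 1 N, (tt n - tt (n-1)) ^ (q+1) *
            ∫ s in tt (n-1)..tt n, (√(lam k) * |⟪iteratedDeriv (q+1) u2 s, φ k⟫|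
              + lam k * |⟪iteratedDeriv (q+1) u1 s, φ k⟫|)) ^ 2 := by
  obtain ⟨K, hK, hosc⟩ := exists_oscillator_nodal_error q
  refine ⟨K, hK, ?_⟩
  intro T N hN tt htt0 httN htt f hf u1 u2 hu1 hu2 hu1mem hd1 hd2 hD1 hD2 k hi1 hi2 c1 c2 hdG
  set ω := √(lam k) with hω
  have hω0 : 0 < ω := Real.sqrt_pos.2 (hlam_pos k)
  have hωsq : ω * ω = lam k := Real.mul_self_sqrt (hlam_pos k).le
  have hsub : ∀ n < N, Set.Icc (tt n) (tt (n + 1)) ⊆ Set.Icc 0 T := fun n hn =>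
    Set.Icc_subset_Icc (htt0 ▸ mesh_le htt (Nat.zero_le n) hn.le) (httN ▸ mesh_le htt hn le_rfl)
  have hsubo : ∀ n < N, Set.Ioo (tt n) (tt (n + 1)) ⊆ Set.Ioo 0 T := fun n hn =>
    Set.Ioo_subset_Ioo (htt0 ▸ mesh_le htt (Nat.zero_le n) hn.le) (httN ▸ mesh_le htt hn le_rfl)
  have hT : 0 ≤ T := by rw [← htt0, ← httN]; exact mesh_le htt (Nat.zero_le N) le_rfl
  have hsubu : ∀ n < N, Set.uIcc (tt n) (tt (n + 1)) ⊆ Set.uIcc 0 T := fun n hn => by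
    rw [Set.uIcc_of_le (htt n hn).le, Set.uIcc_of_le hT]; exact hsub n hn
  have hfk : IntervalIntegrable (fun t => ⟪f t, φ k⟫) volume 0 T := by
    rw [intervalIntegrable_iff] at hf ⊢
    exact hf.inner_const (φ k)
  have cx : ContinuousOn (fun t => ⟪u1 t, φ k⟫) (Set.Icc 0 T) := hu1.inner continuousOn_const
  have cy : ContinuousOn (fun t => ⟪u2 t, φ k⟫) (Set.Icc 0 T) := hu2.inner continuousOn_const
  have step := hosc N tt htt (fun n => C ω * modePoly q c1 (φ k) n)
    (fun n => modePoly q c2 (φ k) n)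
    (fun n => by rw [← smul_eq_C_mul]; exact Submodule.smul_mem _ _ (modePoly_mem q c1 (φ k) n))
    (fun n => modePoly_mem q c2 (φ k) n)
    (fun t => ω * ⟪u1 t, φ k⟫) (fun t => ⟪u2 t, φ k⟫)
    (fun n hn => continuousOn_const.mul (cx.mono (hsub n hn)))
    (fun n hn => cy.mono (hsub n hn)) ω hω0.le
    (fun n => ω * modeNodal q c1 (φ k) tt ⟪u1 0, φ k⟫ n)
    (modeNodal q c2 (φ k) tt ⟪u2 0, φ k⟫)
    (fun n => ω * ((tt (n + 1) - tt n) ^ q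
      * ∫ s in tt n..tt (n + 1), |⟪iteratedDeriv (q+1) u1 s, φ k⟫|))
    (fun n => (tt (n + 1) - tt n) ^ q
      * ∫ s in tt n..tt (n + 1), |⟪iteratedDeriv (q+1) u2 s, φ k⟫|)
    (by simp [modeNodal, htt0]) (by simp [modeNodal, htt0])
    (fun n _ => by simp [modeNodal]) (fun n _ => by simp [modeNodal])
    (fun n hn => by
      obtain ⟨Q, hQ, hb⟩ := exists_approx_Icc (htt n hn) q
        (fun m t => ⟪iteratedDeriv m u1 t, φ k⟫)
        (by simpa using cx.mono (hsub n hn))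
        (fun m hm t ht => hasDerivAt_inner_const (hD1 m hm t (hsubo n hn ht)) (φ k))
        (hi1.mono_set (hsubu n hn))
      refine ⟨ω • Q, Submodule.smul_mem _ _ hQ, fun t ht => ?_⟩
      have := hb t ht
      rw [iteratedDeriv_zero] at this
      rw [eval_smul, smul_eq_mul, ← mul_sub, abs_mul, abs_of_pos hω0]
      gcongr)
    (fun n hn => by
      obtain ⟨Q, hQ, hb⟩ := exists_approx_Icc (htt n hn) q
        (fun m t => ⟪iteratedDeriv m u2 t, φ k⟫)
        (by simpa using cy.mono (hsub n hn))
        (fun m hm t ht => hasDerivAt_inner_const (hD2 m hm t (hsubo n hn ht)) (φ k))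
        (hi2.mono_set (hsubu n hn))
      exact ⟨Q, hQ, fun t ht => by simpa using hb t ht⟩)
    (fun n hn v hv => by
      have e := (mode_equations hφ hdG (hlam_pos k) hn hv).1
      have ex := integral_mul_eval_eq (htt n hn).le (cx.mono (hsub n hn))
        (fun t ht => hasDerivAt_inner_const (hd1 t (hsubo n hn ht)) (φ k))
        ((cy.mono ((hsubu n hn).trans (Set.uIcc_of_le hT).subset)).intervalIntegrable) v
      simp only [derivative_C_mul, eval_mul, eval_C, mul_assoc,
        intervalIntegral.integral_const_mul]
      linear_combination ω * e + ω * ex)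
    (fun n hn v hv => by
      have e := (mode_equations hφ hdG (hlam_pos k) hn hv).2
      have ix : IntervalIntegrable (fun s => ⟪u1 s, φ k⟫) volume (tt n) (tt (n + 1)) :=
        (cx.mono ((hsubu n hn).trans (Set.uIcc_of_le hT).subset)).intervalIntegrable
      have hfn := hfk.mono_set (hsubu n hn)
      have ex := integral_mul_eval_eq (htt n hn).le (cy.mono (hsub n hn))
        (g := fun t => ⟪f t, φ k⟫ - lam k * ⟪u1 t, φ k⟫)
        (fun t ht => by
          have := hasDerivAt_inner_const (hd2 t (hsubo n hn ht)) (φ k)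
          rwa [inner_sub_left, inner_Aop hφ (hu1mem t)] at this)
        (hfn.sub (ix.const_mul _)) v
      simp only [sub_mul, mul_assoc] at ex
      rw [intervalIntegral.integral_sub (hfn.mul_continuousOn v.continuous.continuousOn)
        ((ix.mul_continuousOn v.continuous.continuousOn).const_mul _),
        intervalIntegral.integral_const_mul] at ex
      simp only [eval_mul, eval_C, mul_assoc, intervalIntegral.integral_const_mul]
      rw [← mul_assoc ω ω, ← mul_assoc ω ω, hωsq]
      linarith)
  have hN0 : N ≠ 0 := by omega
  simp only [modeNodal, hN0, if_false] at step
  rw [inner_sub_left, inner_sub_left, inner_pval, inner_pval]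
  refine (le_of_eq ?_).trans (step.trans (le_of_eq ?_))
  · linear_combination -(eval (tt N) (modePoly q c1 (φ k) N) - ⟪u1 (tt N), φ k⟫) ^ 2 * hωsq
  · congr 2
    rw [← Finset.Ico_add_one_right_eq_Icc, Finset.sum_Ico_eq_sum_range, Nat.add_sub_cancel]
    refine Finset.sum_congr rfl fun n hn => ?_
    rw [Finset.mem_range] at hn
    rw [add_comm 1 n, Nat.add_sub_cancel, intervalIntegral.integral_add
      ((hi2.mono_set (hsubu n hn)).abs.const_mul _) ((hi1.mono_set (hsubu n hn)).abs.const_mul _),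
      intervalIntegral.integral_const_mul, intervalIntegral.integral_const_mul, ← hωsq]
    ring

/-- A discrete Minkowski inequality for integrals. -/
lemma sqrt_sum_sq_le_sum_integral {S J : Finset ℕ} {E : ℕ → ℝ} (hE0 : ∀ k, 0 ≤ E k) {c a b : ℕ → ℝ}
    (hc : ∀ n ∈ J, 0 ≤ c n) (hab : ∀ n ∈ J, a n ≤ b n) {g : ℕ → ℝ → ℝ} {h : ℝ → ℝ}
    (hg : ∀ k, ∀ n ∈ J, IntervalIntegrable (g k) volume (a n) (b n))
    (hh : ∀ n ∈ J, IntervalIntegrable h volume (a n) (b n)) (hh0 : ∀ s, 0 ≤ h s)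
    (hgh : ∀ s, ∑ k ∈ S, E k * g k s ≤ √(∑ k ∈ S, E k ^ 2) * h s)
    (hE : ∀ k, E k ≤ ∑ n ∈ J, c n * ∫ s in a n..b n, g k s) :
    √(∑ k ∈ S, E k ^ 2) ≤ ∑ n ∈ J, c n * ∫ s in a n..b n, h s := by
  have hsq : 0 ≤ ∑ k ∈ S, E k ^ 2 := Finset.sum_nonneg fun k _ => sq_nonneg _
  have hR : 0 ≤ ∑ n ∈ J, c n * ∫ s in a n..b n, h s := Finset.sum_nonneg fun n hn =>
    mul_nonneg (hc n hn) (intervalIntegral.integral_nonneg (hab n hn) fun s _ => hh0 s)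
  have key : √(∑ k ∈ S, E k ^ 2) * √(∑ k ∈ S, E k ^ 2)
      ≤ √(∑ k ∈ S, E k ^ 2) * ∑ n ∈ J, c n * ∫ s in a n..b n, h s := by
    rw [Real.mul_self_sqrt hsq]
    calc ∑ k ∈ S, E k ^ 2
        ≤ ∑ k ∈ S, E k * ∑ n ∈ J, c n * ∫ s in a n..b n, g k s :=
          Finset.sum_le_sum fun k _ => by
            rw [sq]; exact mul_le_mul_of_nonneg_left (hE k) (hE0 k)
      _ = ∑ n ∈ J, c n * ∫ s in a n..b n, ∑ k ∈ S, E k * g k s := by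
          simp only [Finset.mul_sum]
          rw [Finset.sum_comm]
          refine Finset.sum_congr rfl fun n hn => ?_
          rw [intervalIntegral.integral_finsetSum fun k _ => (hg k n hn).const_mul _,
            Finset.mul_sum]
          refine Finset.sum_congr rfl fun k _ => ?_
          rw [intervalIntegral.integral_const_mul]
          ring
      _ ≤ ∑ n ∈ J, c n * ∫ s in a n..b n, √(∑ k ∈ S, E k ^ 2) * h s := by
          refine Finset.sum_le_sum fun n hn => mul_le_mul_of_nonneg_left ?_ (hc n hn)
          refine intervalIntegral.integral_mono_on (hab n hn) ?_ ((hh n hn).const_mul _)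
            fun s _ => hgh s
          have := IntervalIntegrable.sum S (f := fun k s => E k * g k s)
            fun k _ => (hg k n hn).const_mul (E k)
          simpa [Finset.sum_fn] using this
      _ = _ := by
          rw [Finset.mul_sum]
          refine Finset.sum_congr rfl fun n _ => ?_
          rw [intervalIntegral.integral_const_mul]
          ring
  rcases (Real.sqrt_nonneg (∑ k ∈ S, E k ^ 2)).eq_or_lt with h0 | hpos
  · rw [← h0]; exact hR
  · exact le_of_mul_le_mul_left key hpos

lemma hsNorm_nonneg (φ : ℕ → H) (lam : ℕ → ℝ) (α : ℝ) (v : H) : 0 ≤ hsNorm φ lam α v :=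
  Real.sqrt_nonneg _

end Exact

end DGWave

/-- **Theorem 4.1, first estimate (nodal error of dG(q) in the energy norm).**
`‖e_{1,N}^-‖₁ + ‖e_{2,N}^-‖ ≤ C Σₙ kₙ^{q+1} ∫_{Iₙ} (‖u₂^{(q+1)}‖₁ + ‖u₁^{(q+1)}‖₂)`. -/
theorem dG_nodal_error_energy
    {H : Type*} [NormedAddCommGroup H] [InnerProductSpace ℝ H] [CompleteSpace H]
    (φ : ℕ → H) (lam : ℕ → ℝ)
    (hφ : Orthonormal ℝ φ)
    (hφtotal : (Submodule.span ℝ (Set.range φ)).topologicalClosure = ⊤)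
    (hlam_pos : ∀ k, 0 < lam k) (hlam_mono : Monotone lam)
    (hlam_top : Filter.Tendsto lam Filter.atTop Filter.atTop)
    (q : ℕ) :
    ∃ C : ℝ, 0 < C ∧
      ∀ (T : ℝ), 0 < T → ∀ (N : ℕ), 1 ≤ N →
      ∀ tt : ℕ → ℝ, tt 0 = 0 → tt N = T → (∀ n < N, tt n < tt (n + 1)) →
      -- data
      ∀ f : ℝ → H, IntervalIntegrable f volume 0 T →
      ∀ u0 v0 : H, MemHs φ lam 1 u0 →
      -- exact solution (u₁,u₂)
      ∀ u1 u2 : ℝ → H,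
      u1 0 = u0 → u2 0 = v0 →
      ContinuousOn u1 (Set.Icc 0 T) → ContinuousOn u2 (Set.Icc 0 T) →
      (∀ t, MemHs φ lam 2 (u1 t)) → (∀ t, MemHs φ lam 1 (u2 t)) →
      (∀ t ∈ Set.Ioo 0 T, HasDerivAt u1 (u2 t) t) →
      (∀ t ∈ Set.Ioo 0 T, HasDerivAt u2 (f t - Aop φ lam (u1 t)) t) →
      -- temporal regularity of the exact solution
      (∀ m < q + 1, ∀ t ∈ Set.Ioo 0 T,
        HasDerivAt (iteratedDeriv m u1) (iteratedDeriv (m+1) u1 t) t) →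
      (∀ m < q + 1, ∀ t ∈ Set.Ioo 0 T,
        HasDerivAt (iteratedDeriv m u2) (iteratedDeriv (m+1) u2 t) t) →
      (∀ t, MemHs φ lam 2 (iteratedDeriv (q+1) u1 t)) →
      (∀ t, MemHs φ lam 1 (iteratedDeriv (q+1) u2 t)) →
      IntervalIntegrable (fun t => hsNorm φ lam 2 (iteratedDeriv (q+1) u1 t)) volume 0 T →
      IntervalIntegrable (fun t => hsNorm φ lam 1 (iteratedDeriv (q+1) u2 t)) volume 0 T →
      -- the dG(q) approximation U = (U₁,U₂) ∈ 𝒱_q (coefficient families c1, c2)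
      ∀ c1 c2 : ℕ → ℕ → H,
      (∀ n j, MemHs φ lam 1 (c1 n j)) → (∀ n j, MemHs φ lam 1 (c2 n j)) →
      (∀ d1 d2 : ℕ → ℕ → H, (∀ n j, MemHs φ lam 1 (d1 n j)) →
        (∀ n j, MemHs φ lam 1 (d2 n j)) →
        Bform φ lam tt N q c1 c2 d1 d2 =
          (∑ n ∈ Finset.Icc 1 N, ∫ s in tt (n-1)..tt n, ⟪f s, pval q d2 n s⟫)
            + aForm φ lam u0 (pval q d1 1 (tt 0)) + ⟪v0, pval q d2 1 (tt 0)⟫) →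
      hsNorm φ lam 1 (pval q c1 N (tt N) - u1 (tt N))
          + ‖pval q c2 N (tt N) - u2 (tt N)‖
        ≤ C * ∑ n ∈ Finset.Icc 1 N, (tt n - tt (n-1)) ^ (q+1) *
            ∫ s in tt (n-1)..tt n,
              (hsNorm φ lam 1 (iteratedDeriv (q+1) u2 s)
                + hsNorm φ lam 2 (iteratedDeriv (q+1) u1 s)) := by
  obtain ⟨K, hK, hmode⟩ := DGWave.exists_mode_nodal_error φ lam hφ hlam_pos q
  refine ⟨2 * K, by positivity, ?_⟩
  intro T hT N hN tt htt0 httN htt f hf u0 v0 _ u1 u2 hu10 hu20 hu1 hu2 hu1mem _ hd1 hd2 hD1 hD2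
    hm1 hm2 hI1 hI2 c1 c2 _ _ hdG
  subst hu10 hu20
  have hw1 : ∀ k, √(lam k) ^ 2 = lam k ^ (1 : ℝ) := fun k => by
    rw [Real.sq_sqrt (hlam_pos k).le, Real.rpow_one]
  have hw2 : ∀ k, lam k ^ 2 = lam k ^ (2 : ℝ) := fun k => (Real.rpow_two _).symm
  have hi1 := DGWave.intervalIntegrable_inner_iteratedDeriv hlam_pos hw2 hlam_pos hm1 hI1
  have hi2 := DGWave.intervalIntegrable_inner_iteratedDeriv hlam_pos hw1
    (fun k => Real.sqrt_pos.2 (hlam_pos k)) hm2 hI2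
  set e1 := pval q c1 N (tt N) - u1 (tt N)
  set e2 := pval q c2 N (tt N) - u2 (tt N)
  set R := ∑ n ∈ Finset.Icc 1 N, (tt n - tt (n-1)) ^ (q+1) * ∫ s in tt (n-1)..tt n,
    (hsNorm φ lam 1 (iteratedDeriv (q+1) u2 s) + hsNorm φ lam 2 (iteratedDeriv (q+1) u1 s))
  have hle : ∀ n ∈ Finset.Icc 1 N, tt (n - 1) ≤ tt n := fun n hn =>
    DGWave.mesh_le htt (Nat.sub_le n 1) (Finset.mem_Icc.1 hn).2
  have hsub : ∀ n ∈ Finset.Icc 1 N, Set.uIcc (tt (n - 1)) (tt n) ⊆ Set.uIcc 0 T := fun n hn => by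
    rw [Set.uIcc_of_le (hle n hn), Set.uIcc_of_le hT.le, ← htt0, ← httN]
    exact Set.Icc_subset_Icc
      (DGWave.mesh_le htt (Nat.zero_le _) ((Nat.sub_le n 1).trans (Finset.mem_Icc.1 hn).2))
      (DGWave.mesh_le htt (Finset.mem_Icc.1 hn).2 le_rfl)
  have hk0 : ∀ n ∈ Finset.Icc 1 N, 0 ≤ (tt n - tt (n - 1)) ^ (q + 1) := fun n hn =>
    pow_nonneg (sub_nonneg.2 (hle n hn)) _
  have hh0 : ∀ s, 0 ≤ hsNorm φ lam 1 (iteratedDeriv (q+1) u2 s)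
      + hsNorm φ lam 2 (iteratedDeriv (q+1) u1 s) := fun s =>
    add_nonneg (DGWave.hsNorm_nonneg ..) (DGWave.hsNorm_nonneg ..)
  have hR0 : 0 ≤ R := Finset.sum_nonneg fun n hn =>
    mul_nonneg (hk0 n hn) (intervalIntegral.integral_nonneg (hle n hn) fun s _ => hh0 s)
  set E : ℕ → ℝ := fun k => √(lam k * ⟪e1, φ k⟫ ^ 2 + ⟪e2, φ k⟫ ^ 2)
  have hEsq : ∀ k, E k ^ 2 = lam k * ⟪e1, φ k⟫ ^ 2 + ⟪e2, φ k⟫ ^ 2 := fun k =>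
    Real.sq_sqrt (by have := hlam_pos k; positivity)
  have hpart : ∀ S : Finset ℕ, ∑ k ∈ S, E k ^ 2 ≤ (K * R) ^ 2 := by
    intro S
    refine (Real.sqrt_le_left (mul_nonneg hK.le hR0)).1 ?_
    have key := DGWave.sqrt_sum_sq_le_sum_integral (S := S) (J := Finset.Icc 1 N) (E := E)
      (fun k => Real.sqrt_nonneg _) (c := fun n => K * (tt n - tt (n-1)) ^ (q+1))
      (a := fun n => tt (n-1)) (b := tt)
      (g := fun k s => √(lam k) * |⟪iteratedDeriv (q+1) u2 s, φ k⟫|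
        + lam k * |⟪iteratedDeriv (q+1) u1 s, φ k⟫|)
      (h := fun s => hsNorm φ lam 1 (iteratedDeriv (q+1) u2 s)
        + hsNorm φ lam 2 (iteratedDeriv (q+1) u1 s))
      (fun n hn => mul_nonneg hK.le (hk0 n hn)) hle
      (fun k n hn => (((hi2 k).mono_set (hsub n hn)).abs.const_mul _).add
        (((hi1 k).mono_set (hsub n hn)).abs.const_mul _))
      (fun n hn => (hI2.mono_set (hsub n hn)).add (hI1.mono_set (hsub n hn))) hh0
      (fun s => by
        simp only [mul_add, Finset.sum_add_distrib]
        refine add_le_add ?_ ?_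
        · exact (Real.sum_mul_le_sqrt_mul_sqrt S E _).trans (mul_le_mul_of_nonneg_left
            (DGWave.sqrt_sum_le_hsNorm hlam_pos hw1 (hm2 s) S) (Real.sqrt_nonneg _))
        · exact (Real.sum_mul_le_sqrt_mul_sqrt S E _).trans (mul_le_mul_of_nonneg_left
            (DGWave.sqrt_sum_le_hsNorm hlam_pos hw2 (hm1 s) S) (Real.sqrt_nonneg _)))
      (fun k => by
        simp only [mul_assoc, ← Finset.mul_sum]
        refine Real.sqrt_le_iff.2 ⟨mul_nonneg hK.le (Finset.sum_nonneg fun n hn =>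
          mul_nonneg (hk0 n hn) (intervalIntegral.integral_nonneg (hle n hn) fun s _ => ?_)), ?_⟩
        · have := hlam_pos k
          positivity
        · exact hmode T N hN tt htt0 httN htt f hf u1 u2 hu1 hu2 hu1mem hd1 hd2 hD1 hD2 k
            (hi1 k) (hi2 k) c1 c2 hdG)
    simpa only [mul_assoc, ← Finset.mul_sum] using key
  have h1 : hsNorm φ lam 1 e1 ≤ K * R := by
    refine Real.sqrt_le_iff.2 ⟨mul_nonneg hK.le hR0, Real.tsum_le_of_sum_le (fun k => ?_)
      fun S => (Finset.sum_le_sum fun k _ => ?_).trans (hpart S)⟩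
    · exact mul_nonneg (Real.rpow_nonneg (hlam_pos k).le _) (sq_nonneg _)
    · rw [hEsq, Real.rpow_one]
      exact le_add_of_nonneg_right (sq_nonneg _)
  have h2 : ‖e2‖ ≤ K * R := by
    refine (sq_le_sq₀ (norm_nonneg _) (mul_nonneg hK.le hR0)).1 ?_
    have hs := (HilbertBasis.mk hφ hφtotal.ge).hasSum_inner_mul_inner e2 e2
    rw [real_inner_self_eq_norm_sq] at hs
    refine hasSum_le_of_sum_le hs fun S => (Finset.sum_le_sum fun k _ => ?_).trans (hpart S)
    rw [hEsq, HilbertBasis.coe_mk, real_inner_comm e2, ← sq]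
    exact le_add_of_nonneg_left (mul_nonneg (hlam_pos k).le (sq_nonneg _))
  linarith
end
end
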